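/- Fix an integer k ≥ 3 and λ ∈ (0,1/2). For every ε > 0 there exists a constant C = C(k,λ,ε) such that the following holds for every n with gcd(n,(k−1)!) = 1 and every integer m with p = m/n ∈ (λ,1−λ). Let x be the indicator vector of a uniformly random m-element subset of ℤ/nℤ, set y_i = (x_i − p)/√(p(1−p)), let kAP′(y) be the degree-≥3 part of kAP(x) in the variables y, and let σ be the standard deviation of kAP′(y) when the x_i are instead i.i.d. Bernoulli(p). Then for all t ∈ ℝ: |E[exp(it·kAP′(y)/σ)] − exp(−t²/2)| ≤ C·(|t|·n^{ε−1/4} + |t|³·n^{−1/2}). -/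

import Mathlib

open MeasureTheory ProbabilityTheory
open scoped ENNReal NNReal

noncomputable section

/-- The uniform probability measure on a subset of a finite type. -/
def finUniform {γ : Type*} [Fintype γ] [MeasurableSpace γ] (s : Set γ) : Measure γ :=
  (Nat.card s : ℝ≥0∞)⁻¹ • ∑ a : γ, s.indicator (fun _ => (1 : ℝ≥0∞)) a • Measure.dirac a

/-- The product Bernoulli(p) measure on `ι → Bool`. -/
def bernoulliPi (ι : Type*) [Fintype ι] [DecidableEq ι] (p : ℝ) : Measure (ι → Bool) :=
  ∑ x : ι → Bool, (∏ i : ι, ENNReal.ofReal (if x i then p else 1 - p)) • Measure.dirac x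

/-- The uniform measure on indicator vectors of `m`-element subsets of `ZMod n`. -/
def uniformSubset (n : ℕ) [NeZero n] (m : ℕ) : Measure (ZMod n → Bool) :=
  finUniform {x | (Finset.univ.filter fun i : ZMod n => x i = true).card = m}

/-- The degree-≥3 part `kAP′(y)` of the expansion of the k-AP count in the
normalized variables `y_i = (x_i − p)/√(p(1−p))`. -/
def kAPprime (k : ℕ) (p : ℝ) {n : ℕ} [NeZero n] (x : ZMod n → Bool) : ℝ :=
  ∑ a : ZMod n, ∑ d ∈ Finset.Icc 1 (n / 2), ∑ S ∈ (Finset.range k).powerset,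
    if 3 ≤ S.card then
      p ^ (k - S.card) * Real.sqrt (p * (1 - p)) ^ S.card *
        ∏ i ∈ S,
          (((if x (a + ((i * d : ℕ) : ZMod n)) then (1 : ℝ) else 0) - p) /
            Real.sqrt (p * (1 - p)))
    else 0

end

open MeasureTheory ProbabilityTheory
open scoped ENNReal NNReal

noncomputable section Basics

def yv (p : ℝ) (b : Bool) : ℝ := ((if b then (1 : ℝ) else 0) - p) / Real.sqrt (p * (1 - p))

def wtb (p : ℝ) (b : Bool) : ℝ := if b then p else 1 - p

variable {V : Type} [Fintype V] [DecidableEq V]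

def Ex {E : Type} [AddCommGroup E] [Module ℝ E] (p : ℝ) (f : (V → Bool) → E) : E :=
  ∑ x, (∏ i, wtb p (x i)) • f x

def mon (p : ℝ) (A : Finset V) (x : V → Bool) : ℝ := ∏ i ∈ A, yv p (x i)

section
variable {E : Type} [AddCommGroup E] [Module ℝ E]

lemma Ex_add (p : ℝ) (f g : (V → Bool) → E) :
    Ex p (fun x => f x + g x) = Ex p f + Ex p g := by
  simp [Ex, Finset.sum_add_distrib]

lemma Ex_sub (p : ℝ) (f g : (V → Bool) → E) :
    Ex p (fun x => f x - g x) = Ex p f - Ex p g := by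
  simp [Ex, smul_sub]

lemma Ex_sum {κ : Type} (s : Finset κ) (p : ℝ) (f : κ → (V → Bool) → E) :
    Ex p (fun x => ∑ a ∈ s, f a x) = ∑ a ∈ s, Ex p (f a) := by
  simp only [Ex, Finset.smul_sum]
  exact Finset.sum_comm

lemma Ex_smul (p r : ℝ) (f : (V → Bool) → E) :
    Ex p (fun x => r • f x) = r • Ex p f := by
  simp only [Ex, Finset.smul_sum]
  exact Finset.sum_congr rfl fun x _ => smul_comm _ _ _
end

lemma Ex_mul (p r : ℝ) (f : (V → Bool) → ℝ) :
    Ex p (fun x => r * f x) = r * Ex p f := Ex_smul p r f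

lemma Ex_cmul (p : ℝ) (r : ℂ) (f : (V → Bool) → ℂ) :
    Ex p (fun x => r * f x) = r * Ex p f := by
  simp only [Ex, Finset.mul_sum]
  exact Finset.sum_congr rfl fun x _ => by simp; ring

lemma Ex_prod (p : ℝ) (f : V → Bool → ℝ) :
    Ex p (fun x : V → Bool => ∏ i, f i (x i)) = ∏ i, (p * f i true + (1 - p) * f i false) := by
  have h : ∀ i, p * f i true + (1 - p) * f i false = ∑ b, wtb p b * f i b := by
    intro i; simp [wtb]
  simp only [h, Finset.prod_univ_sum, Fintype.piFinset_univ, Ex, smul_eq_mul]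
  exact Finset.sum_congr rfl fun x _ => by rw [Finset.prod_mul_distrib]

lemma Ex_const (p r : ℝ) : Ex p (fun _ : V → Bool => r) = r := by
  have := Ex_prod (V := V) p (fun _ _ => 1)
  have h2 := Ex_mul (V := V) p r (fun _ => 1)
  simp at this h2
  simp [h2, this]

lemma wt_nonneg {p : ℝ} (h0 : 0 ≤ p) (h1 : p ≤ 1) (x : V → Bool) : 0 ≤ ∏ i, wtb p (x i) :=
  Finset.prod_nonneg fun i _ => by unfold wtb; split_ifs <;> linarith

lemma Ex_mono {p : ℝ} (h0 : 0 ≤ p) (h1 : p ≤ 1) {f g : (V → Bool) → ℝ} (h : ∀ x, f x ≤ g x) :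
    Ex p f ≤ Ex p g :=
  Finset.sum_le_sum fun x _ => mul_le_mul_of_nonneg_left (h x) (wt_nonneg h0 h1 x)

lemma norm_Ex_le {p : ℝ} (h0 : 0 ≤ p) (h1 : p ≤ 1) {E : Type} [NormedAddCommGroup E]
    [NormedSpace ℝ E] (f : (V → Bool) → E) :
    ‖Ex p f‖ ≤ Ex p (fun x => ‖f x‖) := by
  refine (norm_sum_le _ _).trans (Finset.sum_le_sum fun x _ => ?_)
  rw [norm_smul, Real.norm_of_nonneg (wt_nonneg h0 h1 x)]; rfl

lemma abs_Ex_le {p : ℝ} (h0 : 0 ≤ p) (h1 : p ≤ 1) {f : (V → Bool) → ℝ} {M : ℝ}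
    (h : ∀ x, |f x| ≤ M) : |Ex p f| ≤ M := by
  have := norm_Ex_le h0 h1 f
  rw [Real.norm_eq_abs] at this
  refine this.trans ((Ex_mono h0 h1 h).trans ?_)
  rw [Ex_const]

def flipAt (j : V) (x : V → Bool) : V → Bool := Function.update x j (!(x j))

lemma flipAt_flipAt (j : V) (x : V → Bool) : flipAt j (flipAt j x) = x := by
  simp [flipAt]

lemma wt_flip (p : ℝ) (j : V) (x : V → Bool) :
    wtb p (x j) * ∏ i, wtb p (flipAt j x i) = wtb p (!(x j)) * ∏ i, wtb p (x i) := by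
  rw [← Finset.mul_prod_erase _ _ (Finset.mem_univ j), ← Finset.mul_prod_erase _ (fun i => wtb p (x i)) (Finset.mem_univ j)]
  have : ∏ i ∈ Finset.univ.erase j, wtb p (flipAt j x i) = ∏ i ∈ Finset.univ.erase j, wtb p (x i) := by
    refine Finset.prod_congr rfl fun i hi => ?_
    simp [flipAt, Function.update_of_ne (Finset.ne_of_mem_erase hi)]
  rw [this]
  simp [flipAt]
  ring

lemma Ex_split {E : Type} [AddCommGroup E] [Module ℝ E] (p : ℝ) (j : V) (F : (V → Bool) → E) :
    Ex p F = Ex p (fun x => p • F (Function.update x j true) +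
      (1 - p) • F (Function.update x j false)) := by
  have h1 : ∀ x : V → Bool, p • F (Function.update x j true) +
      (1 - p) • F (Function.update x j false) =
      wtb p (x j) • F x + wtb p (!(x j)) • F (flipAt j x) := by
    intro x
    cases hx : x j
    · have : Function.update x j false = x := by rw [← hx]; simp
      simp [wtb, flipAt, hx, this, add_comm]
    · have : Function.update x j true = x := by rw [← hx]; simp
      simp [wtb, flipAt, hx, this]
  simp only [h1]
  rw [Ex_add]
  have h2 : Ex p (fun x => wtb p (!(x j)) • F (flipAt j x)) = Ex p (fun x => wtb p (!(x j)) • F x) := by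
    unfold Ex
    refine Finset.sum_nbij' (flipAt j) (flipAt j) (by simp) (by simp)
      (fun x _ => flipAt_flipAt j x) (fun x _ => flipAt_flipAt j x) fun x _ => ?_
    have := wt_flip p j x
    simp only [smul_smul]
    congr 1
    have h3 : (!(flipAt j x j)) = x j := by simp [flipAt]
    rw [h3, mul_comm, ← this, mul_comm]
  rw [h2, ← Ex_add]
  congr 1; ext x
  rw [← add_smul]
  cases x j <;> simp [wtb]

lemma s_sq {p : ℝ} (h0 : 0 < p) (h1 : p < 1) : Real.sqrt (p * (1 - p)) ^ 2 = p * (1 - p) :=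
  Real.sq_sqrt (by nlinarith)

lemma s_pos {p : ℝ} (h0 : 0 < p) (h1 : p < 1) : 0 < Real.sqrt (p * (1 - p)) :=
  Real.sqrt_pos.2 (by nlinarith)

lemma yv_mean {p : ℝ} : p * yv p true + (1 - p) * yv p false = 0 := by
  simp [yv]; ring

lemma yv_sq {p : ℝ} (h0 : 0 < p) (h1 : p < 1) :
    p * yv p true ^ 2 + (1 - p) * yv p false ^ 2 = 1 := by
  have := s_sq h0 h1
  have h := s_pos h0 h1
  simp only [yv, div_pow, this]
  have : p * (1 - p) ≠ 0 := by nlinarith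
  have : 1 - p ≠ 0 := by linarith
  field_simp
  simp; ring

def IndepOf {E : Type} (j : V) (F : (V → Bool) → E) : Prop := ∀ x b, F (Function.update x j b) = F x

section
variable {E : Type} [AddCommGroup E] [Module ℝ E]

lemma Ex_y_indep {p : ℝ} {j : V} {F : (V → Bool) → E} (hF : IndepOf j F) :
    Ex p (fun x => yv p (x j) • F x) = 0 := by
  rw [Ex_split p j]
  simp only [hF _ _, Function.update_self, smul_smul, ← add_smul, yv_mean]
  simp [Ex]

lemma Ex_y2_indep {p : ℝ} (h0 : 0 < p) (h1 : p < 1) {j : V} {F : (V → Bool) → E}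
    (hF : IndepOf j F) :
    Ex p (fun x => (yv p (x j) ^ 2) • F x) = Ex p F := by
  rw [Ex_split p j]
  simp only [hF _ _, Function.update_self, smul_smul, ← add_smul, yv_sq h0 h1, one_smul]
end

lemma mon_indep (p : ℝ) (A : Finset V) (j : V) (hj : j ∉ A) : IndepOf j (mon p A) := by
  intro x b
  refine Finset.prod_congr rfl fun i hi => ?_
  rw [Function.update_of_ne]; rintro rfl; exact hj hi

lemma mon_eq (p : ℝ) (A : Finset V) (x : V → Bool) :
    mon p A x = ∏ i, (if i ∈ A then yv p (x i) else 1) := by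
  rw [mon, Finset.prod_ite_mem]; simp

lemma mon_abs_le {p B : ℝ} (hB : 1 ≤ B) (hy : ∀ b, |yv p b| ≤ B) {A : Finset V} {k : ℕ}
    (hA : A.card ≤ k) (x : V → Bool) : |mon p A x| ≤ B ^ k := by
  rw [mon, Finset.abs_prod]
  calc _ ≤ ∏ i ∈ A, B := Finset.prod_le_prod (fun _ _ => abs_nonneg _) fun i _ => hy _
    _ = B ^ A.card := by simp
    _ ≤ _ := pow_le_pow_right₀ hB hA

lemma mon_mul_mon_nonneg {p : ℝ} (h0 : 0 < p) (h1 : p < 1) (A A' : Finset V) :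
    0 ≤ Ex p (fun x => mon p A x * mon p A' x) := by
  simp only [mon_eq, ← Finset.prod_mul_distrib]
  rw [Ex_prod p (fun i b => (if i ∈ A then yv p b else 1) * (if i ∈ A' then yv p b else 1))]
  refine Finset.prod_nonneg fun i _ => ?_
  have e1 := yv_mean (p := p)
  have e2 := yv_sq h0 h1
  by_cases h : i ∈ A <;> by_cases h' : i ∈ A' <;> simp [h, h'] <;> nlinarith

lemma mon_sq {p : ℝ} (h0 : 0 < p) (h1 : p < 1) (A : Finset V) :
    Ex p (fun x => mon p A x * mon p A x) = 1 := by
  simp only [mon_eq, ← Finset.prod_mul_distrib]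
  rw [Ex_prod p (fun i b => (if i ∈ A then yv p b else 1) * (if i ∈ A then yv p b else 1))]
  refine Finset.prod_eq_one fun i _ => ?_
  have e2 := yv_sq h0 h1
  by_cases h : i ∈ A <;> simp [h] <;> nlinarith

/-- product of four monomials with an isolated point has mean zero -/
lemma Ex_single {p : ℝ} {A B C D : Finset V} {i : V} (hA : i ∈ A) (hB : i ∉ B) (hC : i ∉ C)
    (hD : i ∉ D) : Ex p (fun x => mon p A x * (mon p B x * (mon p C x * mon p D x))) = 0 := by
  have : (fun x => mon p A x * (mon p B x * (mon p C x * mon p D x))) =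
      fun x => yv p (x i) • (mon p (A.erase i) x * (mon p B x * (mon p C x * mon p D x))) := by
    ext x
    rw [mon, ← Finset.mul_prod_erase _ _ hA, ← mon, smul_eq_mul, mul_assoc]
  rw [this]
  apply Ex_y_indep
  intro x b
  simp only
  rw [mon_indep p _ i (Finset.notMem_erase i A), mon_indep p _ i hB, mon_indep p _ i hC,
    mon_indep p _ i hD]

lemma Ex_indep_prod {p : ℝ} {A B C D : Finset V} (h : Disjoint (A ∪ B) (C ∪ D)) :
    Ex p (fun x => (mon p A x * mon p B x) * (mon p C x * mon p D x)) =
      Ex p (fun x => mon p A x * mon p B x) * Ex p (fun x => mon p C x * mon p D x) := by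
  simp only [mon_eq, ← Finset.prod_mul_distrib]
  rw [Ex_prod p (fun i b => ((if i ∈ A then yv p b else 1) * (if i ∈ B then yv p b else 1)) *
     ((if i ∈ C then yv p b else 1) * (if i ∈ D then yv p b else 1))),
     Ex_prod p (fun i b => ((if i ∈ A then yv p b else 1) * (if i ∈ B then yv p b else 1))),
     Ex_prod p (fun i b => ((if i ∈ C then yv p b else 1) * (if i ∈ D then yv p b else 1))),
     ← Finset.prod_mul_distrib]
  refine Finset.prod_congr rfl fun i _ => ?_
  by_cases hi : i ∈ A ∪ B
  · have := Finset.disjoint_left.1 h hi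
    simp only [Finset.mem_union, not_or] at this
    simp [this.1, this.2]
  · simp only [Finset.mem_union, not_or] at hi
    simp [hi.1, hi.2]

end Basics

open MeasureTheory ProbabilityTheory
open scoped ENNReal NNReal

noncomputable section Stein

def ce (t w : ℝ) : ℂ := Complex.exp (Complex.I * Complex.ofReal (t * w))

lemma ce_norm (t w : ℝ) : ‖ce t w‖ = 1 := by
  rw [ce, mul_comm, Complex.norm_exp_ofReal_mul_I]

lemma ce_add (t a b : ℝ) : ce t (a + b) = ce t a * ce t b := by
  rw [ce, ce, ce, ← Complex.exp_add]; congr 1; push_cast; ring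

lemma ce_sub_one (t a : ℝ) : ‖ce t a - 1‖ ≤ |t| * |a| := by
  have := Real.norm_exp_I_mul_ofReal_sub_one_le (x := t * a)
  rw [Real.norm_eq_abs, abs_mul] at this
  exact this

lemma ce_sub_two (t a : ℝ) :
    ‖ce t a - 1 - Complex.I * ((t * a : ℝ) : ℂ)‖ ≤ 2 * (t ^ 2 * a ^ 2) := by
  have hn : ‖Complex.I * ((t * a : ℝ) : ℂ)‖ = |t * a| := by
    rw [norm_mul, Complex.norm_I, Complex.norm_real, one_mul, Real.norm_eq_abs]
  have hsq : t ^ 2 * a ^ 2 = |t * a| ^ 2 := by rw [sq_abs]; ring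
  rw [hsq]
  by_cases h : |t * a| ≤ 1
  · have := Complex.norm_exp_sub_one_sub_id_le (x := Complex.I * ((t * a : ℝ) : ℂ)) (by rw [hn]; exact h)
    rw [hn] at this
    refine this.trans ?_
    nlinarith [sq_nonneg |t * a|]
  · push Not at h
    calc _ ≤ ‖ce t a - 1‖ + ‖Complex.I * ((t * a : ℝ) : ℂ)‖ := norm_sub_le _ _
      _ ≤ |t * a| + |t * a| := by
        rw [hn]; have := ce_sub_one t a; rw [← abs_mul] at this; linarith
      _ ≤ _ := by nlinarith

variable {V : Type} [Fintype V] [DecidableEq V]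

lemma stein_one {p B : ℝ} (h0 : 0 < p) (h1 : p < 1) (hB : 1 ≤ B) (hy : ∀ b, |yv p b| ≤ B)
    {j : V} {W W0 G D : (V → Bool) → ℝ} (hs : ∀ x, W x = W0 x + yv p (x j) * D x)
    (hW0 : IndepOf j W0) (hG : IndepOf j G) (hD : IndepOf j D) (t : ℝ) :
    ‖Ex p (fun x => ((yv p (x j) * G x : ℝ) : ℂ) * ce t (W x)) -
      Complex.I * t * Ex p (fun x => ((G x * D x : ℝ) : ℂ) * ce t (W x))‖ ≤
      3 * B ^ 3 * t ^ 2 * Ex p (fun x => |G x| * D x ^ 2) := by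
  have e1 : Ex p (fun x => yv p (x j) • (((G x : ℝ) : ℂ) * ce t (W0 x))) = 0 :=
    Ex_y_indep (fun x b => by simp only [hG x b, hW0 x b])
  have e2 : Ex p (fun x => (yv p (x j) ^ 2) • (((G x * D x : ℝ) : ℂ) * ce t (W0 x))) =
      Ex p (fun x => (((G x * D x : ℝ) : ℂ) * ce t (W0 x))) :=
    Ex_y2_indep h0 h1 (fun x b => by simp only [hG x b, hW0 x b, hD x b])
  have key : Ex p (fun x => ((yv p (x j) * G x : ℝ) : ℂ) * ce t (W x)) -
      Complex.I * t * Ex p (fun x => ((G x * D x : ℝ) : ℂ) * ce t (W x)) =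
      Ex p (fun x => ((yv p (x j) * G x : ℝ) : ℂ) * ce t (W0 x) *
          (ce t (yv p (x j) * D x) - 1 - Complex.I * ((t * (yv p (x j) * D x) : ℝ) : ℂ))
        - Complex.I * t * ((G x * D x : ℝ) : ℂ) * ce t (W0 x) * (ce t (yv p (x j) * D x) - 1)) := by
    have : ∀ x, ((yv p (x j) * G x : ℝ) : ℂ) * ce t (W0 x) *
          (ce t (yv p (x j) * D x) - 1 - Complex.I * ((t * (yv p (x j) * D x) : ℝ) : ℂ))
        - Complex.I * t * ((G x * D x : ℝ) : ℂ) * ce t (W0 x) * (ce t (yv p (x j) * D x) - 1)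
      = ((((yv p (x j) * G x : ℝ) : ℂ) * ce t (W x) -
         (Complex.I * t) * (((G x * D x : ℝ) : ℂ) * ce t (W x))) -
        yv p (x j) • (((G x : ℝ) : ℂ) * ce t (W0 x))) -
        ((Complex.I * t) * ((yv p (x j) ^ 2) • (((G x * D x : ℝ) : ℂ) * ce t (W0 x))) -
        (Complex.I * t) * (((G x * D x : ℝ) : ℂ) * ce t (W0 x))) := by
      intro x
      rw [hs, ce_add]
      simp only [Complex.real_smul]
      push_cast
      ring
    simp only [this]
    rw [Ex_sub, Ex_sub, Ex_sub, Ex_sub, e1, Ex_cmul, Ex_cmul, Ex_cmul, e2]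
    simp
  rw [key]
  refine (norm_Ex_le h0.le h1.le _).trans ?_
  rw [← Ex_mul]
  refine Ex_mono h0.le h1.le fun x => ?_
  have hyx := hy (x j)
  have a1 := ce_sub_two t (yv p (x j) * D x)
  have a2 := ce_sub_one t (yv p (x j) * D x)
  refine (norm_sub_le _ _).trans ?_
  simp only [norm_mul, ce_norm, Complex.norm_I, Complex.norm_real, Real.norm_eq_abs, mul_one, one_mul, abs_mul]
  set Y := |yv p (x j)| with hY
  have hY0 : 0 ≤ Y := abs_nonneg _
  have hg : 0 ≤ |G x| := abs_nonneg _
  have hd : 0 ≤ |D x| := abs_nonneg _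
  have ht : 0 ≤ |t| := abs_nonneg _
  have hB3 : B ≤ B ^ 3 := le_self_pow₀ hB (by norm_num)
  have hY3 : Y ^ 3 ≤ B ^ 3 := pow_le_pow_left₀ hY0 hyx 3
  have q1 : Y * |G x| * ‖ce t (yv p (x j) * D x) - 1 - Complex.I * ((t * (yv p (x j) * D x) : ℝ) : ℂ)‖ ≤ 2 * (Y ^ 3 * (t ^ 2 * (|G x| * D x ^ 2))) := by
    calc _ ≤ Y * |G x| * (2 * (t ^ 2 * (yv p (x j) * D x) ^ 2)) := by gcongr
      _ = 2 * (Y * Y ^ 2 * (t ^ 2 * (|G x| * D x ^ 2))) := by rw [hY, sq_abs]; ring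
      _ = _ := by ring
  have q2 : |t| * (|G x| * |D x|) * ‖ce t (yv p (x j) * D x) - 1‖ ≤ Y * (t ^ 2 * (|G x| * D x ^ 2)) := by
    calc _ ≤ |t| * (|G x| * |D x|) * (|t| * |yv p (x j) * D x|) := by gcongr
      _ = Y * (|t| ^ 2 * (|G x| * |D x| ^ 2)) := by rw [abs_mul]; ring
      _ = _ := by rw [sq_abs, sq_abs]
  have q3 : 0 ≤ t ^ 2 * (|G x| * D x ^ 2) := by positivity
  calc _ ≤ 2 * (Y ^ 3 * (t ^ 2 * (|G x| * D x ^ 2))) + Y * (t ^ 2 * (|G x| * D x ^ 2)) := by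
        refine add_le_add ?_ ?_
        · convert q1 using 2
        · convert q2 using 2
    _ ≤ 2 * (B ^ 3 * (t ^ 2 * (|G x| * D x ^ 2))) + B ^ 3 * (t ^ 2 * (|G x| * D x ^ 2)) := by
        gcongr; linarith
    _ = _ := by ring

lemma stein_var {p : ℝ} (h0 : 0 < p) (h1 : p < 1)
    {W : (V → Bool) → ℝ} {W0 G D : V → (V → Bool) → ℝ}
    (hW : ∀ x, W x = ∑ j, yv p (x j) * G j x)
    (hs : ∀ j x, W x = W0 j x + yv p (x j) * D j x)
    (hW0 : ∀ j, IndepOf j (W0 j)) (hG : ∀ j, IndepOf j (G j)) (hD : ∀ j, IndepOf j (D j)) :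
    Ex p (fun x => W x ^ 2) = Ex p (fun x => ∑ j, G j x * D j x) := by
  have : ∀ x, W x ^ 2 = ∑ j, (yv p (x j) • (G j x * W0 j x) + yv p (x j) ^ 2 • (G j x * D j x)) := by
    intro x
    rw [sq]; nth_rw 1 [hW x]
    rw [Finset.sum_mul]
    refine Finset.sum_congr rfl fun j _ => ?_
    rw [hs j x]; simp only [smul_eq_mul]; ring
  simp only [this]
  rw [Ex_sum, Ex_sum]
  refine Finset.sum_congr rfl fun j _ => ?_
  rw [Ex_add, Ex_y_indep (fun x b => by simp only [hG j x b, hW0 j x b]), zero_add,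
    Ex_y2_indep h0 h1 (fun x b => by simp only [hG j x b, hD j x b])]

lemma ode_bound {φ φ' : ℝ → ℂ} (hφ : ∀ s, HasDerivAt φ (φ' s) s) (hφ0 : φ 0 = 1) {η₁ η₂ : ℝ}
    (h1 : 0 ≤ η₁) (h2 : 0 ≤ η₂) (hb : ∀ s, ‖φ' s + s * φ s‖ ≤ η₁ * |s| + η₂ * s ^ 2) (t : ℝ) :
    ‖φ t - ((Real.exp (-(t ^ 2) / 2) : ℝ) : ℂ)‖ ≤ η₁ * t ^ 2 + η₂ * |t| ^ 3 := by
  set ψ : ℝ → ℂ := fun s => φ s * ((Real.exp ((s ^ 2 - t ^ 2) / 2) : ℝ) : ℂ) with hψ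
  have hd : ∀ s, HasDerivAt ψ ((φ' s + s * φ s) * ((Real.exp ((s ^ 2 - t ^ 2) / 2) : ℝ) : ℂ)) s := by
    intro s
    have e : HasDerivAt (fun s : ℝ => Real.exp ((s ^ 2 - t ^ 2) / 2))
        (Real.exp ((s ^ 2 - t ^ 2) / 2) * s) s := by
      have := (((hasDerivAt_pow 2 s).sub_const (t ^ 2)).div_const 2).exp
      refine this.congr_deriv ?_
      simp
    have := (hφ s).mul e.ofReal_comp
    refine this.congr_deriv ?_
    push_cast; ring
  have hc := Convex.norm_image_sub_le_of_norm_hasDerivWithin_le (f := ψ)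
    (C := η₁ * |t| + η₂ * t ^ 2) (s := Set.Icc (-|t|) |t|) (x := 0) (y := t)
    (fun s _ => (hd s).hasDerivWithinAt) (fun s hs => by
      have hst : |s| ≤ |t| := abs_le.2 hs
      have hst2 : s ^ 2 ≤ t ^ 2 := sq_le_sq.2 hst
      rw [norm_mul, Complex.norm_real, Real.norm_of_nonneg (Real.exp_pos _).le]
      have : Real.exp ((s ^ 2 - t ^ 2) / 2) ≤ 1 := Real.exp_le_one_iff.2 (by linarith)
      calc _ ≤ (η₁ * |s| + η₂ * s ^ 2) * 1 := by
            refine mul_le_mul (hb s) this (Real.exp_pos _).le (by positivity)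
        _ ≤ _ := by rw [mul_one]; gcongr) (convex_Icc _ _) (by simp) (abs_le.1 le_rfl)
  simp only [hψ] at hc
  rw [hφ0] at hc
  have e1 : (((t : ℝ) ^ 2 - t ^ 2) / 2) = 0 := by simp
  have e2 : (((0 : ℝ) ^ 2 - t ^ 2) / 2) = -(t ^ 2) / 2 := by ring
  rw [e1, e2] at hc
  simp only [Real.exp_zero, Complex.ofReal_one, mul_one, one_mul, sub_zero, Real.norm_eq_abs] at hc
  refine hc.trans (le_of_eq ?_)
  rw [← sq_abs t]; ring

lemma ce_deriv (w s : ℝ) : HasDerivAt (fun t => ce t w) (Complex.I * w * ce s w) s := by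
  have h : HasDerivAt (fun t : ℝ => ((t * w : ℝ) : ℂ)) (w : ℂ) s := by
    have := ((hasDerivAt_id s).mul_const w).ofReal_comp
    simpa using this
  have := (h.const_mul Complex.I).cexp
  refine this.congr_deriv ?_
  simp only [ce]; ring

lemma stein_clt {p B : ℝ} (h0 : 0 < p) (h1 : p < 1) (hB : 1 ≤ B) (hy : ∀ b, |yv p b| ≤ B)
    {W : (V → Bool) → ℝ} {W0 G D : V → (V → Bool) → ℝ}
    (hW : ∀ x, W x = ∑ j, yv p (x j) * G j x)
    (hs : ∀ j x, W x = W0 j x + yv p (x j) * D j x)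
    (hW0 : ∀ j, IndepOf j (W0 j)) (hG : ∀ j, IndepOf j (G j)) (hD : ∀ j, IndepOf j (D j))
    {η₁ η₂ : ℝ} (hη₁ : Ex p (fun x => |∑ j, G j x * D j x - 1|) ≤ η₁)
    (hη₂ : ∑ j, Ex p (fun x => |G j x| * D j x ^ 2) ≤ η₂) (t : ℝ) :
    ‖Ex p (fun x => ce t (W x)) - ((Real.exp (-(t ^ 2) / 2) : ℝ) : ℂ)‖ ≤
      η₁ * t ^ 2 + 3 * B ^ 3 * η₂ * |t| ^ 3 := by
  have hp1 : 0 ≤ η₁ := le_trans (by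
    rw [← Ex_const (V := V) p 0]; exact Ex_mono h0.le h1.le fun x => abs_nonneg _) hη₁
  have hp2 : 0 ≤ η₂ := le_trans (Finset.sum_nonneg fun j _ => by
    rw [← Ex_const (V := V) p 0]; exact Ex_mono h0.le h1.le fun x => by positivity) hη₂
  refine ode_bound (φ := fun t => Ex p (fun x => ce t (W x)))
    (φ' := fun t => Ex p (fun x => Complex.I * W x * ce t (W x))) ?_ ?_ hp1 (by positivity) ?_ t
  · intro s
    unfold Ex
    refine HasDerivAt.fun_sum fun x _ => ?_
    exact (ce_deriv (W x) s).const_smul _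
  · have := Ex_const (V := V) p 1
    simp only [ce, zero_mul, Complex.ofReal_zero, mul_zero, Complex.exp_zero]
    simp only [Ex, smul_eq_mul, mul_one] at this
    simp only [Ex, Complex.real_smul, mul_one]
    rw [← Complex.ofReal_sum, this]; simp
  · intro s
    have e : Ex p (fun x => Complex.I * W x * ce s (W x)) + s * Ex p (fun x => ce s (W x)) =
        Complex.I * ∑ j, (Ex p (fun x => ((yv p (x j) * G j x : ℝ) : ℂ) * ce s (W x)) -
      Complex.I * s * Ex p (fun x => ((G j x * D j x : ℝ) : ℂ) * ce s (W x))) -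
        s * Ex p (fun x => ((∑ j, G j x * D j x - 1 : ℝ) : ℂ) * ce s (W x)) := by
      have a1 : Ex p (fun x => Complex.I * W x * ce s (W x)) = Complex.I * ∑ j, Ex p (fun x => ((yv p (x j) * G j x : ℝ) : ℂ) * ce s (W x)) := by
        rw [← Ex_sum, ← Ex_cmul]
        congr 1; ext x
        rw [← Finset.sum_mul, ← Complex.ofReal_sum, ← hW x]; ring
      have a2 : Ex p (fun x => ((∑ j, G j x * D j x - 1 : ℝ) : ℂ) * ce s (W x)) =
          ∑ j, Ex p (fun x => ((G j x * D j x : ℝ) : ℂ) * ce s (W x)) - Ex p (fun x => ce s (W x)) := by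
        rw [← Ex_sum, ← Ex_sub]
        congr 1; ext x
        rw [← Finset.sum_mul, ← Complex.ofReal_sum]; push_cast; ring
      rw [a1, a2, Finset.sum_sub_distrib, ← Finset.mul_sum]
      ring_nf
      simp only [Complex.I_sq]
      ring
    rw [e]
    refine (norm_sub_le _ _).trans ?_
    rw [norm_mul, norm_mul, Complex.norm_I, one_mul, Complex.norm_real, Real.norm_eq_abs, add_comm]
    refine add_le_add ?_ ?_
    · rw [mul_comm]
      refine mul_le_mul_of_nonneg_right ?_ (abs_nonneg _)
      refine le_trans ?_ hη₁
      refine (norm_Ex_le h0.le h1.le _).trans (Ex_mono h0.le h1.le fun x => ?_)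
      rw [norm_mul, ce_norm, Complex.norm_real, mul_one]; rfl
    · calc _ ≤ ∑ j, 3 * B ^ 3 * s ^ 2 * Ex p (fun x => |G j x| * D j x ^ 2) :=
            (norm_sum_le _ _).trans (Finset.sum_le_sum fun j _ =>
              stein_one h0 h1 hB hy (hs j) (hW0 j) (hG j) (hD j) s)
        _ = 3 * B ^ 3 * s ^ 2 * ∑ j, Ex p (fun x => |G j x| * D j x ^ 2) := by rw [Finset.mul_sum]
        _ ≤ 3 * B ^ 3 * s ^ 2 * η₂ := by gcongr
        _ = _ := by ring

end Stein

open MeasureTheory ProbabilityTheory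
open scoped ENNReal NNReal

noncomputable section Counting

open Classical in
def cnt {α : Type} [Fintype α] (P : α → Prop) : ℕ := (Finset.univ.filter P).card

lemma cnt_eq {α : Type} [Fintype α] (P : α → Prop) [DecidablePred P] :
    cnt P = (Finset.univ.filter P).card := by
  unfold cnt; congr

lemma cnt_mono {α : Type} [Fintype α] {P Q : α → Prop} (h : ∀ a, P a → Q a) : cnt P ≤ cnt Q := by
  classical
  unfold cnt
  exact Finset.card_le_card fun a ha => by simp at ha ⊢; exact h a ha

lemma cnt_or {α : Type} [Fintype α] (P Q : α → Prop) : cnt (fun a => P a ∨ Q a) ≤ cnt P + cnt Q := by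
  classical
  simp only [cnt_eq]
  rw [Finset.filter_or]
  exact Finset.card_union_le _ _

lemma cnt_true {α : Type} [Fintype α] : cnt (fun _ : α => True) = Fintype.card α := by
  simp [cnt]

lemma cnt_exists {α β : Type} [Fintype α] (s : Finset β) (P : β → α → Prop) (N : ℕ)
    (h : ∀ b ∈ s, cnt (P b) ≤ N) : cnt (fun a => ∃ b ∈ s, P b a) ≤ s.card * N := by
  classical
  simp only [cnt_eq] at *
  have : (Finset.univ.filter fun a => ∃ b ∈ s, P b a) ⊆ s.biUnion fun b => Finset.univ.filter (P b) := by
    intro a ha; simpa using ha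
  refine (Finset.card_le_card this).trans ?_
  refine Finset.card_biUnion_le_card_mul _ _ _ fun b hb => ?_
  exact h b hb

lemma cnt_fib {α β : Type} [Fintype α] [Fintype β] (P : α × β → Prop) (Q : α → Prop) {M N : ℕ}
    (h : ∀ a b, P (a, b) → Q a) (hQ : cnt Q ≤ M) (hP : ∀ a, Q a → cnt (fun b => P (a, b)) ≤ N) :
    cnt P ≤ M * N := by
  classical
  unfold cnt at *
  have e : (Finset.univ.filter P).card = ∑ a ∈ Finset.univ.filter Q,
      (Finset.univ.filter fun b => P (a, b)).card := by
    rw [← Finset.card_sigma]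
    refine Finset.card_bij (fun z _ => ⟨z.1, z.2⟩) ?_ ?_ ?_
    · rintro ⟨a, b⟩ hz; simp at hz ⊢; exact ⟨h a b hz, hz⟩
    · rintro ⟨a, b⟩ _ ⟨a', b'⟩ _ hh; simp at hh; simp [hh]
    · rintro ⟨a, b⟩ hz; simp at hz ⊢; exact hz.2
  rw [e]
  calc _ ≤ ∑ a ∈ Finset.univ.filter Q, N := Finset.sum_le_sum fun a ha => by
        simp at ha
        convert hP a ha
    _ = (Finset.univ.filter Q).card * N := by simp
    _ ≤ M * N := Nat.mul_le_mul_right _ (by convert hQ)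

lemma cnt_swap {α β : Type} [Fintype α] [Fintype β] (P : α × β → Prop) :
    cnt P = cnt (fun z : β × α => P (z.2, z.1)) := by
  classical
  unfold cnt
  refine Finset.card_bij (fun z _ => (z.2, z.1)) ?_ ?_ ?_
  · rintro ⟨a, b⟩ hz; simpa using hz
  · rintro ⟨a, b⟩ _ ⟨a', b'⟩ _ hh; simp at hh; simp [hh]
  · rintro ⟨a, b⟩ hz; simpa using hz

lemma cnt_fib' {α β : Type} [Fintype α] [Fintype β] (P : α × β → Prop) (Q : β → Prop) {M N : ℕ}
    (h : ∀ a b, P (a, b) → Q b) (hQ : cnt Q ≤ M) (hP : ∀ b, Q b → cnt (fun a => P (a, b)) ≤ N) :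
    cnt P ≤ M * N := by
  rw [cnt_swap]
  exact cnt_fib _ Q (fun b a => h a b) hQ hP

lemma cnt_mem {α : Type} [Fintype α] (s : Finset α) : cnt (fun a => a ∈ s) = s.card := by
  classical
  unfold cnt; congr 1; ext; simp

lemma sum_le_cnt {α : Type} [Fintype α] (P : α → Prop) (f : α → ℝ) {M : ℝ}
    (h0 : ∀ a, ¬ P a → f a = 0) (hM : ∀ a, |f a| ≤ M) : |∑ a, f a| ≤ M * cnt P := by
  classical
  have : ∑ a, f a = ∑ a ∈ Finset.univ.filter P, f a := by
    symm
    refine Finset.sum_subset (Finset.subset_univ _) fun a _ ha => h0 a (by simpa using ha)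
  rw [this]
  calc _ ≤ ∑ a ∈ Finset.univ.filter P, M :=
        (Finset.abs_sum_le_sum_abs _ _).trans (Finset.sum_le_sum fun a _ => hM a)
    _ = _ := by simp [cnt, mul_comm]

variable {V ι : Type} [Fintype V] [DecidableEq V] [Fintype ι]

def P2 (T : ι → Finset V) (K : ℕ) : Prop :=
  ∀ i j : V, i ≠ j → cnt (fun α => i ∈ T α ∧ j ∈ T α) ≤ K

variable {T : ι → Finset V} {K k : ℕ}

lemma P2.two (hP : P2 T K) (Z : Finset V) {z : ℕ} (hz : Z.card ≤ z) :
    cnt (fun α => 2 ≤ (T α ∩ Z).card) ≤ z ^ 2 * K := by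
  have := cnt_exists Z.offDiag (fun ij α => ij.1 ∈ T α ∧ ij.2 ∈ T α) K (fun ij h => by
    simp at h; exact hP _ _ h.2.2)
  refine le_trans (cnt_mono ?_) (this.trans ?_)
  · intro α h
    obtain ⟨a, b, ha, hb, hab⟩ := Finset.one_lt_card_iff.1 h
    simp at ha hb
    exact ⟨(a, b), by simp [ha, hb, hab], by simp [ha, hb]⟩
  · refine Nat.mul_le_mul_right _ ?_
    rw [Finset.offDiag_card, sq]
    exact (Nat.sub_le _ _).trans (Nat.mul_le_mul hz hz)

lemma P2.one (hP : P2 T K) (h2 : ∀ α, 2 ≤ (T α).card) (i : V) :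
    cnt (fun α => i ∈ T α) ≤ Fintype.card V * K := by
  have := cnt_exists (Finset.univ.erase i) (fun j α => i ∈ T α ∧ j ∈ T α) K (fun j h => by
    exact hP _ _ (Finset.ne_of_mem_erase h).symm)
  refine le_trans (cnt_mono ?_) (this.trans ?_)
  · intro α h
    obtain ⟨b, hb, hbi⟩ := Finset.exists_mem_ne (h2 α) i
    exact ⟨b, by simp [hbi], h, hb⟩
  · exact Nat.mul_le_mul_right _ (Finset.card_le_univ _)

lemma P2.meet (hP : P2 T K) (h2 : ∀ α, 2 ≤ (T α).card) (Z : Finset V) {z : ℕ} (hz : Z.card ≤ z) :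
    cnt (fun α => ∃ i ∈ Z, i ∈ T α) ≤ z * (Fintype.card V * K) :=
  (cnt_exists Z (fun i α => i ∈ T α) _ (fun i _ => hP.one h2 i)).trans (Nat.mul_le_mul_right _ hz)

lemma P2.zero (hP : P2 T K) (h2 : ∀ α, 2 ≤ (T α).card) :
    cnt (fun _ : ι => True) ≤ Fintype.card V * (Fintype.card V * K) := by
  refine le_trans (cnt_mono ?_) (hP.meet h2 Finset.univ (z := Fintype.card V) (by simp))
  intro α _
  have : (T α).Nonempty := Finset.card_pos.1 (by have := h2 α; omega)
  obtain ⟨i, hi⟩ := this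
  exact ⟨i, by simp, hi⟩

lemma two_le_inter {A B : Finset V} {i j : V} (hij : i ≠ j) (h1 : i ∈ A) (h2 : j ∈ A) (h3 : i ∈ B)
    (h4 : j ∈ B) : 2 ≤ (A ∩ B).card :=
  Finset.one_lt_card_iff.2 ⟨i, j, by simp [*], by simp [*], hij⟩

/-! fourth moments -/

def Good4 (T : ι → Finset V) (j : V) (z : (ι × ι) × (ι × ι)) : Prop :=
  (j ∈ T z.1.1 ∧ j ∈ T z.1.2 ∧ j ∈ T z.2.1 ∧ j ∈ T z.2.2) ∧
  (2 ≤ (T z.1.1 ∩ T z.1.2).card ∨ 2 ≤ (T z.2.1 ∩ T z.1.1).card ∨ 2 ≤ (T z.2.2 ∩ T z.1.1).card) ∧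
  2 ≤ (T z.2.2 ∩ (T z.1.1 ∪ T z.1.2 ∪ T z.2.1)).card ∧
  2 ≤ (T z.2.1 ∩ (T z.1.1 ∪ T z.1.2 ∪ T z.2.2)).card

lemma card_u3 {A B C : Finset V} (hA : A.card ≤ k) (hB : B.card ≤ k) (hC : C.card ≤ k) :
    (A ∪ B ∪ C).card ≤ 3 * k := by
  have := Finset.card_union_le (A ∪ B) C
  have := Finset.card_union_le A B
  omega

lemma cnt_good4 (hP : P2 T K) (h2 : ∀ α, 2 ≤ (T α).card) (hk : ∀ α, (T α).card ≤ k) (j : V) :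
    cnt (Good4 T j) ≤ 3 * ((Fintype.card V * K) * (Fintype.card V * K) * ((k ^ 2 * K) * ((3 * k) ^ 2 * K))) := by
  have h1 := hP.one h2 j
  have c1 : cnt (fun z : (ι × ι) × (ι × ι) => (j ∈ T z.1.1 ∧ j ∈ T z.2.1) ∧ 2 ≤ (T z.1.2 ∩ T z.1.1).card ∧ 2 ≤ (T z.2.2 ∩ (T z.1.1 ∪ T z.1.2 ∪ T z.2.1)).card) ≤
     ((Fintype.card V * K) * (k ^ 2 * K)) * ((Fintype.card V * K) * ((3 * k) ^ 2 * K)) := by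
    refine cnt_fib _ (fun u => j ∈ T u.1 ∧ 2 ≤ (T u.2 ∩ T u.1).card) (fun a b h => ⟨h.1.1, h.2.1⟩) ?_ ?_
    · exact cnt_fib _ (fun a => j ∈ T a) (fun a b h => h.1) h1 fun a _ =>
        (cnt_mono fun b h => h.2).trans (hP.two (T a) (hk a))
    · rintro ⟨a, b⟩ _
      refine cnt_fib _ (fun a => j ∈ T a) (fun a b h => h.1.2) h1 fun c _ =>
        (cnt_mono fun d h => h.2.2).trans (hP.two _ (card_u3 (hk a) (hk b) (hk c)))
  have c0 : cnt (fun u : ι × ι => j ∈ T u.1 ∧ j ∈ T u.2) ≤ (Fintype.card V * K) * (Fintype.card V * K) :=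
    cnt_fib _ (fun a => j ∈ T a) (fun a b h => h.1) h1 fun a _ => (cnt_mono fun b h => h.2).trans h1
  have c2 : cnt (fun z : (ι × ι) × (ι × ι) => (j ∈ T z.1.1 ∧ j ∈ T z.1.2) ∧ 2 ≤ (T z.2.1 ∩ T z.1.1).card ∧ 2 ≤ (T z.2.2 ∩ (T z.1.1 ∪ T z.1.2 ∪ T z.2.1)).card) ≤
     (Fintype.card V * K) * (Fintype.card V * K) * ((k ^ 2 * K) * ((3 * k) ^ 2 * K)) := by
    refine cnt_fib _ (fun u => j ∈ T u.1 ∧ j ∈ T u.2) (fun a b h => h.1) c0 ?_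
    rintro ⟨a, b⟩ _
    exact cnt_fib _ (fun c => 2 ≤ (T c ∩ T a).card) (fun c d h => h.2.1) (hP.two _ (hk a)) fun c _ =>
      (cnt_mono fun d h => h.2.2).trans (hP.two _ (card_u3 (hk a) (hk b) (hk c)))
  have c3 : cnt (fun z : (ι × ι) × (ι × ι) => (j ∈ T z.1.1 ∧ j ∈ T z.1.2) ∧ 2 ≤ (T z.2.2 ∩ T z.1.1).card ∧ 2 ≤ (T z.2.1 ∩ (T z.1.1 ∪ T z.1.2 ∪ T z.2.2)).card) ≤
     (Fintype.card V * K) * (Fintype.card V * K) * ((k ^ 2 * K) * ((3 * k) ^ 2 * K)) := by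
    refine cnt_fib _ (fun u => j ∈ T u.1 ∧ j ∈ T u.2) (fun a b h => h.1) c0 ?_
    rintro ⟨a, b⟩ _
    exact cnt_fib' _ (fun c => 2 ≤ (T c ∩ T a).card) (fun c d h => h.2.1) (hP.two _ (hk a)) fun c _ =>
      (cnt_mono fun d h => h.2.2).trans (hP.two _ (card_u3 (hk a) (hk b) (hk c)))
  have := (cnt_or _ _).trans (Nat.add_le_add c1 ((cnt_or _ _).trans (Nat.add_le_add c2 c3)))
  refine le_trans (cnt_mono ?_) (this.trans (le_of_eq (by ring)))
  rintro ⟨⟨a, b⟩, ⟨c, d⟩⟩ ⟨⟨ha, hb, hc, hd⟩, h, h3, h4⟩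
  simp only at *
  rcases h with h | h | h
  · left; rw [Finset.inter_comm] at h; exact ⟨⟨ha, hc⟩, h, h3⟩
  · right; left; exact ⟨⟨ha, hb⟩, h, h3⟩
  · right; right; exact ⟨⟨ha, hb⟩, h, h4⟩

lemma sum_pow_four (f : ι → ℝ) :
    (∑ a, f a) ^ 4 = ∑ z : (ι × ι) × (ι × ι), f z.1.1 * (f z.1.2 * (f z.2.1 * f z.2.2)) := by
  have h : (∑ a, f a) ^ 2 = ∑ u : ι × ι, f u.1 * f u.2 := by
    rw [sq, Finset.sum_mul_sum, Fintype.sum_prod_type]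
  have : (∑ a, f a) ^ 4 = ((∑ a, f a) ^ 2) * (∑ a, f a) ^ 2 := by ring
  rw [this, h, Finset.sum_mul_sum]
  symm
  refine (Fintype.sum_prod_type _).trans ?_
  refine Finset.sum_congr rfl fun u _ => Finset.sum_congr rfl fun v _ => ?_
  simp only; ring

def link (T : ι → Finset V) (b : ι → ℝ) (p : ℝ) (j : V) (x : V → Bool) : ℝ :=
  ∑ α, if j ∈ T α then b α * mon p ((T α).erase j) x else 0

lemma link_indep (b : ι → ℝ) (p : ℝ) (j : V) : IndepOf j (link T b p j) := by
  intro x c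
  refine Finset.sum_congr rfl fun α _ => ?_
  rw [mon_indep p _ j (Finset.notMem_erase j _)]

lemma exists_other {A : Finset V} (h : 2 ≤ A.card) (j : V) : ∃ i ∈ A, i ≠ j :=
  Finset.exists_mem_ne h j

lemma link_four {p B β : ℝ} (h0 : 0 < p) (h1 : p < 1) (hB : 1 ≤ B) (hy : ∀ b, |yv p b| ≤ B)
    (hβ : 0 ≤ β)
    (hP : P2 T K) (h2 : ∀ α, 2 ≤ (T α).card) (hk : ∀ α, (T α).card ≤ k) {b : ι → ℝ}
    (hb : ∀ α, |b α| ≤ β) (j : V) :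
    Ex p (fun x => link T b p j x ^ 4) ≤ (β * B ^ k) ^ 4 * (27 * k ^ 4 * K ^ 4) * (Fintype.card V : ℝ) ^ 2 := by
  simp only [link, sum_pow_four]
  rw [Ex_sum]
  refine (le_abs_self _).trans ?_
  have hB0 : 0 ≤ B := by linarith
  refine (sum_le_cnt (Good4 T j) _ (M := (β * B ^ k) ^ 4) ?_ ?_).trans ?_
  · rintro ⟨⟨a, b'⟩, ⟨c, d⟩⟩ hz
    simp only
    by_cases ha : j ∈ T a; swap
    · simp [ha, Ex]
    by_cases hb' : j ∈ T b'; swap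
    · simp [hb', Ex]
    by_cases hc : j ∈ T c; swap
    · simp [hc, Ex]
    by_cases hd : j ∈ T d; swap
    · simp [hd, Ex]
    simp only [ha, hb', hc, hd, if_true]
    have e : ∀ x, b a * mon p ((T a).erase j) x * (b b' * mon p ((T b').erase j) x * (b c * mon p ((T c).erase j) x * (b d * mon p ((T d).erase j) x))) = (b a * b b' * b c * b d) * (mon p ((T a).erase j) x * (mon p ((T b').erase j) x * (mon p ((T c).erase j) x * mon p ((T d).erase j) x))) := fun x => by ring
    simp only [e]
    rw [Ex_mul]
    simp only [Good4, ha, hb', hc, hd, true_and, not_and_or, not_or] at hz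
    rcases hz with ⟨z1, z2, z3⟩ | z | z
    · obtain ⟨i, hi, hij⟩ := exists_other (h2 a) j
      rw [Ex_single (i := i) (by simp [hi, hij])
        (fun h => z1 (two_le_inter hij hi ha (Finset.mem_of_mem_erase h) hb'))
        (fun h => z2 (two_le_inter hij (Finset.mem_of_mem_erase h) hc hi ha))
        (fun h => z3 (two_le_inter hij (Finset.mem_of_mem_erase h) hd hi ha)), mul_zero]
    · obtain ⟨i, hi, hij⟩ := exists_other (h2 d) j
      have e2 : ∀ x, mon p ((T a).erase j) x * (mon p ((T b').erase j) x * (mon p ((T c).erase j) x * mon p ((T d).erase j) x)) = mon p ((T d).erase j) x * (mon p ((T a).erase j) x * (mon p ((T b').erase j) x * (mon p ((T c).erase j) x))) := fun x => by ring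
      simp only [e2]
      rw [Ex_single (i := i) (by simp [hi, hij])
        (fun h => z (two_le_inter hij hi hd (by simp [Finset.mem_of_mem_erase h]) (by simp [ha])))
        (fun h => z (two_le_inter hij hi hd (by simp [Finset.mem_of_mem_erase h]) (by simp [ha])))
        (fun h => z (two_le_inter hij hi hd (by simp [Finset.mem_of_mem_erase h]) (by simp [ha]))), mul_zero]
    · obtain ⟨i, hi, hij⟩ := exists_other (h2 c) j
      have e2 : ∀ x, mon p ((T a).erase j) x * (mon p ((T b').erase j) x * (mon p ((T c).erase j) x * mon p ((T d).erase j) x)) = mon p ((T c).erase j) x * (mon p ((T a).erase j) x * (mon p ((T b').erase j) x * (mon p ((T d).erase j) x))) := fun x => by ring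
      simp only [e2]
      rw [Ex_single (i := i) (by simp [hi, hij])
        (fun h => z (two_le_inter hij hi hc (by simp [Finset.mem_of_mem_erase h]) (by simp [ha])))
        (fun h => z (two_le_inter hij hi hc (by simp [Finset.mem_of_mem_erase h]) (by simp [ha])))
        (fun h => z (two_le_inter hij hi hc (by simp [Finset.mem_of_mem_erase h]) (by simp [ha]))), mul_zero]
  · rintro ⟨⟨a, b'⟩, ⟨c, d⟩⟩
    refine abs_Ex_le h0.le h1.le fun x => ?_
    have e : ∀ a, |if j ∈ T a then b a * mon p ((T a).erase j) x else 0| ≤ β * B ^ k := by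
      intro a
      split_ifs
      · rw [abs_mul]
        exact mul_le_mul (hb a) (mon_abs_le hB hy ((Finset.card_erase_le).trans (hk a)) x)
          (abs_nonneg _) hβ
      · simp; positivity
    simp only [abs_mul]
    calc _ ≤ (β * B ^ k) * ((β * B ^ k) * ((β * B ^ k) * (β * B ^ k))) := by
          gcongr <;> apply e
      _ = _ := by ring
  · have := cnt_good4 hP h2 hk j
    have h' : (cnt (Good4 T j) : ℝ) ≤ ((3 * ((Fintype.card V * K) * (Fintype.card V * K) * ((k ^ 2 * K) * ((3 * k) ^ 2 * K))) : ℕ) : ℝ) := by exact_mod_cast this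
    calc _ ≤ (β * B ^ k) ^ 4 * ((3 * ((Fintype.card V * K) * (Fintype.card V * K) * ((k ^ 2 * K) * ((3 * k) ^ 2 * K))) : ℕ) : ℝ) := by gcongr
      _ = _ := by push_cast; ring

end Counting

open MeasureTheory ProbabilityTheory
open scoped ENNReal NNReal

noncomputable section GammaVar

variable {V ι : Type} [Fintype V] [DecidableEq V] [Fintype ι]
variable {T : ι → Finset V} {K k : ℕ}

def HH (T : ι → Finset V) (h : (ι × ι) × V) : Prop := h.2 ∈ T h.1.1 ∧ h.2 ∈ T h.1.2

def RR1 (T : ι → Finset V) (z : ((ι × ι) × V) × ((ι × ι) × V)) : Prop :=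
  HH T z.1 ∧ HH T z.2 ∧ 2 ≤ (T z.1.1.1 ∩ (T z.2.1.1 ∪ T z.2.1.2)).card ∧
    2 ≤ (T z.1.1.2 ∩ (T z.2.1.1 ∪ T z.2.1.2)).card

def RR3 (T : ι → Finset V) (z : ((ι × ι) × V) × ((ι × ι) × V)) : Prop :=
  HH T z.1 ∧ HH T z.2 ∧ 2 ≤ (T z.1.1.2 ∩ T z.1.1.1).card ∧ 2 ≤ (T z.2.1.2 ∩ T z.2.1.1).card ∧
    ((∃ i ∈ T z.1.1.1 ∪ T z.1.1.2, i ∈ T z.2.1.1) ∨ (∃ i ∈ T z.1.1.1 ∪ T z.1.1.2, i ∈ T z.2.1.2))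

def RR (T : ι → Finset V) (z : ((ι × ι) × V) × ((ι × ι) × V)) : Prop :=
  RR1 T z ∨ RR1 T (z.2, z.1) ∨ RR3 T z

lemma card_u2 {A B : Finset V} (hA : A.card ≤ k) (hB : B.card ≤ k) :
    (A ∪ B).card ≤ 2 * k := by
  have := Finset.card_union_le A B
  omega

lemma cnt_RR1 (hP : P2 T K) (h2 : ∀ α, 2 ≤ (T α).card) (hk : ∀ α, (T α).card ≤ k) :
    cnt (RR1 T) ≤ ((Fintype.card V * (Fintype.card V * K)) * (k * (Fintype.card V * K)) * k) *
      ((((2 * k) ^ 2 * K) * ((2 * k) ^ 2 * K)) * k) := by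
  refine cnt_fib' _ (HH T) (fun a b h => h.2.1) ?_ ?_
  · refine cnt_fib _ (fun u => ∃ i ∈ T u.1, i ∈ T u.2) (fun a b h => ⟨b, h.1, h.2⟩) ?_ ?_
    · exact cnt_fib _ (fun _ => True) (fun _ _ _ => trivial) (hP.zero h2) fun a _ =>
        hP.meet h2 (T a) (hk a)
    · rintro ⟨a, b⟩ _
      refine (cnt_mono (Q := fun j => j ∈ T a) fun j h => h.1).trans ?_
      rw [cnt_mem]; exact hk a
  · rintro ⟨⟨a, b⟩, j⟩ _
    have hc := card_u2 (hk a) (hk b)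
    refine cnt_fib _ (fun u => 2 ≤ (T u.1 ∩ (T a ∪ T b)).card ∧ 2 ≤ (T u.2 ∩ (T a ∪ T b)).card)
      (fun a b h => h.2.2) ?_ ?_
    · exact cnt_fib _ (fun a' => 2 ≤ (T a' ∩ (T a ∪ T b)).card) (fun _ _ h => h.1)
        (hP.two _ hc) fun _ _ => (cnt_mono fun _ h => h.2).trans (hP.two _ hc)
    · rintro ⟨a', b'⟩ _
      refine (cnt_mono (Q := fun j => j ∈ T a') fun j h => h.1.1).trans ?_
      rw [cnt_mem]; exact hk a'

lemma cnt_RR3 (hP : P2 T K) (h2 : ∀ α, 2 ≤ (T α).card) (hk : ∀ α, (T α).card ≤ k) :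
    cnt (RR3 T) ≤ ((Fintype.card V * (Fintype.card V * K)) * (k ^ 2 * K) * k) *
      ((((2 * k) * (Fintype.card V * K)) * (k ^ 2 * K) + ((2 * k) * (Fintype.card V * K)) * (k ^ 2 * K)) * k) := by
  refine cnt_fib _ (fun h => 2 ≤ (T h.1.2 ∩ T h.1.1).card ∧ h.2 ∈ T h.1.1) (fun a b h => ⟨h.2.2.1, h.1.1⟩) ?_ ?_
  · refine cnt_fib _ (fun u => 2 ≤ (T u.2 ∩ T u.1).card) (fun a b h => h.1) ?_ ?_
    · exact cnt_fib _ (fun _ => True) (fun _ _ _ => trivial) (hP.zero h2) fun a _ =>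
        hP.two (T a) (hk a)
    · rintro ⟨a, b⟩ _
      refine (cnt_mono (Q := fun j => j ∈ T a) fun j h => h.2).trans ?_
      rw [cnt_mem]; exact hk a
  · rintro ⟨⟨a, b⟩, j⟩ _
    have hc := card_u2 (hk a) (hk b)
    refine cnt_fib _ (fun u => (2 ≤ (T u.2 ∩ T u.1).card ∧ ∃ i ∈ T a ∪ T b, i ∈ T u.1) ∨
        (2 ≤ (T u.2 ∩ T u.1).card ∧ ∃ i ∈ T a ∪ T b, i ∈ T u.2))
      (fun a b h => ?_) ?_ ?_
    · rcases h.2.2.2.2 with h' | h'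
      · exact Or.inl ⟨h.2.2.2.1, h'⟩
      · exact Or.inr ⟨h.2.2.2.1, h'⟩
    · refine (cnt_or _ _).trans (Nat.add_le_add ?_ ?_)
      · exact cnt_fib _ (fun a' => ∃ i ∈ T a ∪ T b, i ∈ T a') (fun _ _ h => h.2)
          (hP.meet h2 _ hc) fun a' _ => (cnt_mono fun _ h => h.1).trans (hP.two _ (hk a'))
      · refine cnt_fib' _ (fun a' => ∃ i ∈ T a ∪ T b, i ∈ T a') (fun _ _ h => h.2)
          (hP.meet h2 _ hc) fun a' _ => (cnt_mono (Q := fun α => 2 ≤ (T α ∩ T a').card) fun _ h => ?_).trans (hP.two _ (hk a'))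
        have := h.1
        rw [Finset.inter_comm] at this; exact this
    · rintro ⟨a', b'⟩ _
      refine (cnt_mono (Q := fun j => j ∈ T a') fun j h => h.2.1.1).trans ?_
      rw [cnt_mem]; exact hk a'

lemma cnt_RR (hP : P2 T K) (h2 : ∀ α, 2 ≤ (T α).card) (hk : ∀ α, (T α).card ≤ k) :
    cnt (RR T) ≤ 36 * k ^ 7 * K ^ 4 * Fintype.card V ^ 3 := by
  have a1 := cnt_RR1 hP h2 hk
  have a2 := a1
  rw [cnt_swap] at a2
  have a3 := cnt_RR3 hP h2 hk
  refine ((cnt_or _ _).trans (Nat.add_le_add a1 ((cnt_or _ _).trans (Nat.add_le_add a2 a3)))).trans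
    (le_of_eq (by ring))

def gam (T : ι → Finset V) (b c : ι → ℝ) (p : ℝ) (h : (ι × ι) × V) (x : V → Bool) : ℝ :=
  (if h.2 ∈ T h.1.1 then b h.1.1 * mon p ((T h.1.1).erase h.2) x else 0) *
  (if h.2 ∈ T h.1.2 then c h.1.2 * mon p ((T h.1.2).erase h.2) x else 0)

lemma gam_sum (b c : ι → ℝ) (p : ℝ) (x : V → Bool) :
    ∑ j, link T b p j x * link T c p j x = ∑ h : (ι × ι) × V, gam T b c p h x := by
  rw [Fintype.sum_prod_type, Finset.sum_comm]
  refine Finset.sum_congr rfl fun j _ => ?_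
  rw [link, link, Finset.sum_mul_sum, Fintype.sum_prod_type]
  rfl

lemma cov_zero_A {p : ℝ} {A B C D : Finset V} {i : V} (hA : i ∈ A) (hB : i ∉ B) (hC : i ∉ C)
    (hD : i ∉ D) : Ex p (fun x => (mon p A x * mon p B x) * (mon p C x * mon p D x)) -
      Ex p (fun x => mon p A x * mon p B x) * Ex p (fun x => mon p C x * mon p D x) = 0 := by
  have e1 := Ex_single (p := p) hA hB hC hD
  have e2 := Ex_single (p := p) (C := ∅) (D := ∅) hA hB (by simp) (by simp)
  simp only [mul_assoc]
  rw [e1]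
  simp [mon] at e2
  simp only [mon]
  rw [e2]; simp

lemma exists_out {A Z : Finset V} {j : V} (hA : 3 ≤ A.card) (h : ¬ 2 ≤ (A ∩ Z).card) :
    ∃ i ∈ A, i ≠ j ∧ i ∉ Z := by
  by_contra hc
  push Not at hc
  apply h
  have : A.erase j ⊆ A ∩ Z := by
    intro i hi
    simp at hi ⊢
    exact ⟨hi.2, hc i hi.2 hi.1⟩
  have h1 := Finset.card_le_card this
  have h2 := Finset.pred_card_le_card_erase (s := A) (a := j)
  omega

lemma cov_half {p : ℝ} {A B C D : Finset V} {j l : V} (hA : 3 ≤ A.card) (hB : 3 ≤ B.card)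
    (jA : j ∈ A) (jB : j ∈ B) (hAB : ¬ 2 ≤ (B ∩ A).card)
    (h : ¬ (2 ≤ (A ∩ (C ∪ D)).card ∧ 2 ≤ (B ∩ (C ∪ D)).card)) :
    Ex p (fun x => (mon p (A.erase j) x * mon p (B.erase j) x) * (mon p (C.erase l) x * mon p (D.erase l) x)) -
      Ex p (fun x => mon p (A.erase j) x * mon p (B.erase j) x) * Ex p (fun x => mon p (C.erase l) x * mon p (D.erase l) x) = 0 := by
  rw [not_and_or] at h
  rcases h with h | h
  · obtain ⟨i, hi, hij, hiZ⟩ := exists_out (j := j) hA h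
    simp only [Finset.mem_union, not_or] at hiZ
    exact cov_zero_A (i := i) (by simp [hi, hij])
      (fun h => hAB (two_le_inter hij (Finset.mem_of_mem_erase h) jB hi jA))
      (fun h => hiZ.1 (Finset.mem_of_mem_erase h)) (fun h => hiZ.2 (Finset.mem_of_mem_erase h))
  · obtain ⟨i, hi, hij, hiZ⟩ := exists_out (j := j) hB h
    simp only [Finset.mem_union, not_or] at hiZ
    have := cov_zero_A (p := p) (A := B.erase j) (B := A.erase j) (C := C.erase l) (D := D.erase l) (i := i) (by simp [hi, hij])
      (fun h => hAB (two_le_inter hij hi jB (Finset.mem_of_mem_erase h) jA))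
      (fun h => hiZ.1 (Finset.mem_of_mem_erase h)) (fun h => hiZ.2 (Finset.mem_of_mem_erase h))
    rw [← this]
    simp only [mul_comm (mon p (A.erase j) _)]

lemma gam_cov_zero {p : ℝ} {b c : ι → ℝ} (h3 : ∀ α, 3 ≤ (T α).card)
    (z : ((ι × ι) × V) × ((ι × ι) × V)) (hz : ¬ RR T z) :
    Ex p (fun x => gam T b c p z.1 x * gam T b c p z.2 x) -
      Ex p (gam T b c p z.1) * Ex p (gam T b c p z.2) = 0 := by
  obtain ⟨⟨⟨a, a'⟩, j⟩, ⟨⟨d, d'⟩, l⟩⟩ := z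
  simp only
  have hzero : (Ex p fun _ : V → Bool => (0 : ℝ)) = 0 := Ex_const p 0
  by_cases h1 : j ∈ T a; swap
  · have : gam T b c p ((a, a'), j) = fun _ => 0 := by ext x; simp [gam, h1]
    simp [this, hzero]
  by_cases h2 : j ∈ T a'; swap
  · have : gam T b c p ((a, a'), j) = fun _ => 0 := by ext x; simp [gam, h2]
    simp [this, hzero]
  by_cases h4 : l ∈ T d; swap
  · have : gam T b c p ((d, d'), l) = fun _ => 0 := by ext x; simp [gam, h4]
    simp [this, hzero]
  by_cases h5 : l ∈ T d'; swap
  · have : gam T b c p ((d, d'), l) = fun _ => 0 := by ext x; simp [gam, h5]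
    simp [this, hzero]
  have g1 : gam T b c p ((a, a'), j) = fun x => (b a * c a') * (mon p ((T a).erase j) x * mon p ((T a').erase j) x) := by
    ext x; simp [gam, h1, h2]; ring
  have g2 : gam T b c p ((d, d'), l) = fun x => (b d * c d') * (mon p ((T d).erase l) x * mon p ((T d').erase l) x) := by
    ext x; simp [gam, h4, h5]; ring
  have g3 : (fun x => gam T b c p ((a, a'), j) x * gam T b c p ((d, d'), l) x) = fun x =>
      ((b a * c a') * (b d * c d')) * ((mon p ((T a).erase j) x * mon p ((T a').erase j) x) * (mon p ((T d).erase l) x * mon p ((T d').erase l) x)) := by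
    ext x; rw [g1, g2]; ring
  rw [g3, g1, g2, Ex_mul, Ex_mul, Ex_mul]
  suffices hs : Ex p (fun x => (mon p ((T a).erase j) x * mon p ((T a').erase j) x) * (mon p ((T d).erase l) x * mon p ((T d').erase l) x)) -
      Ex p (fun x => mon p ((T a).erase j) x * mon p ((T a').erase j) x) * Ex p (fun x => mon p ((T d).erase l) x * mon p ((T d').erase l) x) = 0 by
    linear_combination ((b a * c a') * (b d * c d')) * hs
  simp only [RR, RR1, RR3, HH, h1, h2, h4, h5, true_and, not_or] at hz
  obtain ⟨z1, z2, z3⟩ := hz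
  by_cases c1 : 2 ≤ (T a' ∩ T a).card; swap
  · exact cov_half (h3 a) (h3 a') h1 h2 c1 z1
  by_cases c2 : 2 ≤ (T d' ∩ T d).card; swap
  · have := cov_half (p := p) (l := j) (h3 d) (h3 d') h4 h5 c2 z2
    rw [← this, mul_comm (Ex p _)]
    congr 2
    ext x; ring
  rw [Ex_indep_prod, sub_self]
  simp only [c1, c2, true_and, not_or] at z3
  rw [Finset.disjoint_left]
  intro i hi hi'
  have hi1 : i ∈ T a ∪ T a' := by simp at hi ⊢; tauto
  simp only [Finset.mem_union] at hi'
  rcases hi' with h | h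
  · exact z3.1 ⟨i, hi1, Finset.mem_of_mem_erase h⟩
  · exact z3.2 ⟨i, hi1, Finset.mem_of_mem_erase h⟩

lemma var_expand {H : Type} [Fintype H] (p : ℝ) (g : H → (V → Bool) → ℝ) :
    Ex p (fun x => (∑ h, g h x - Ex p (fun x => ∑ h, g h x)) ^ 2) =
      ∑ z : H × H, (Ex p (fun x => g z.1 x * g z.2 x) - Ex p (g z.1) * Ex p (g z.2)) := by
  set m := Ex p (fun x => ∑ h, g h x) with hm
  have e1 : ∀ x, (∑ h, g h x - m) ^ 2 = (∑ z : H × H, g z.1 x * g z.2 x) - ((2 * m) * (∑ h, g h x) - m ^ 2) := by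
    intro x
    rw [Fintype.sum_prod_type]
    simp only
    rw [← Finset.sum_mul_sum]; ring
  simp only [e1]
  rw [Ex_sub, Ex_sub, Ex_mul, ← hm, Ex_const, Ex_sum, Finset.sum_sub_distrib]
  congr 1
  rw [Fintype.sum_prod_type]
  simp only
  rw [← Finset.sum_mul_sum, ← Ex_sum, ← hm]; ring

lemma gam_var {p B β : ℝ} (h0 : 0 < p) (h1 : p < 1) (hB : 1 ≤ B) (hy : ∀ b, |yv p b| ≤ B)
    (hβ : 0 ≤ β)
    (hP : P2 T K) (h3 : ∀ α, 3 ≤ (T α).card) (hk : ∀ α, (T α).card ≤ k) {b c : ι → ℝ}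
    (hb : ∀ α, |b α| ≤ β) (hc : ∀ α, |c α| ≤ β) :
    Ex p (fun x => (∑ j, link T b p j x * link T c p j x -
      Ex p (fun x => ∑ j, link T b p j x * link T c p j x)) ^ 2) ≤
      (β * B ^ k) ^ 4 * (72 * k ^ 7 * K ^ 4) * (Fintype.card V : ℝ) ^ 3 := by
  simp only [gam_sum]
  rw [var_expand]
  have hB0 : 0 ≤ B := by linarith
  have hg : ∀ h x, |gam T b c p h x| ≤ (β * B ^ k) ^ 2 := by
    intro h x
    have e : ∀ (b : ι → ℝ) (hb : ∀ α, |b α| ≤ β) (j : V) (a : ι), |if j ∈ T a then b a * mon p ((T a).erase j) x else 0| ≤ β * B ^ k := by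
      intro b hb j a
      split_ifs
      · rw [abs_mul]
        exact mul_le_mul (hb a) (mon_abs_le hB hy ((Finset.card_erase_le).trans (hk a)) x)
          (abs_nonneg _) hβ
      · simp; positivity
    rw [gam, abs_mul, sq]
    exact mul_le_mul (e b hb _ _) (e c hc _ _) (abs_nonneg _) (by positivity)
  refine (le_abs_self _).trans ?_
  refine (sum_le_cnt (RR T) _ (M := 2 * (β * B ^ k) ^ 4) (fun z hz => gam_cov_zero h3 z hz) ?_).trans ?_
  · intro z
    have q1 : |Ex p (fun x => gam T b c p z.1 x * gam T b c p z.2 x)| ≤ (β * B ^ k) ^ 2 * (β * B ^ k) ^ 2 :=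
      abs_Ex_le h0.le h1.le fun x => by
        rw [abs_mul]; exact mul_le_mul (hg _ _) (hg _ _) (abs_nonneg _) (by positivity)
    have q2 : |Ex p (gam T b c p z.1) * Ex p (gam T b c p z.2)| ≤ (β * B ^ k) ^ 2 * (β * B ^ k) ^ 2 := by
      rw [abs_mul]
      exact mul_le_mul (abs_Ex_le h0.le h1.le fun x => hg _ _) (abs_Ex_le h0.le h1.le fun x => hg _ _) (abs_nonneg _) (by positivity)
    refine (abs_sub _ _).trans ?_
    linarith
  · have h' : (cnt (RR T) : ℝ) ≤ ((36 * k ^ 7 * K ^ 4 * Fintype.card V ^ 3 : ℕ) : ℝ) := by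
      exact_mod_cast cnt_RR hP (fun α => le_trans (by norm_num) (h3 α)) hk
    calc _ ≤ 2 * (β * B ^ k) ^ 4 * ((36 * k ^ 7 * K ^ 4 * Fintype.card V ^ 3 : ℕ) : ℝ) := by gcongr
      _ = _ := by push_cast; ring

def poly (T : ι → Finset V) (c : ι → ℝ) (p : ℝ) (x : V → Bool) : ℝ := ∑ α, c α * mon p (T α) x

lemma mon_erase {p : ℝ} {A : Finset V} {j : V} (hj : j ∈ A) (x : V → Bool) :
    yv p (x j) * mon p (A.erase j) x = mon p A x := by
  rw [mon, mon, Finset.mul_prod_erase _ (fun i => yv p (x i)) hj]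

lemma link_weighted (b : ι → ℝ) (p : ℝ) (x : V → Bool) :
    ∑ j, yv p (x j) * link T b p j x = ∑ α, (b α * (T α).card) * mon p (T α) x := by
  simp only [link, Finset.mul_sum]
  rw [Finset.sum_comm]
  refine Finset.sum_congr rfl fun α _ => ?_
  have : ∀ j, yv p (x j) * (if j ∈ T α then b α * mon p ((T α).erase j) x else 0) =
      if j ∈ T α then b α * mon p (T α) x else 0 := by
    intro j
    split_ifs with h
    · rw [← mon_erase h]; ring
    · simp
  simp only [this]
  rw [Finset.sum_ite_mem]
  simp; ring

lemma poly_split (c : ι → ℝ) (p : ℝ) (j : V) (x : V → Bool) :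
    poly T c p x = (∑ α, if j ∈ T α then 0 else c α * mon p (T α) x) + yv p (x j) * link T c p j x := by
  rw [poly, link, Finset.mul_sum, ← Finset.sum_add_distrib]
  refine Finset.sum_congr rfl fun α _ => ?_
  split_ifs with h
  · rw [← mon_erase h]; ring
  · ring

theorem iid_clt {p B κ : ℝ} (h0 : 0 < p) (h1 : p < 1) (hB : 1 ≤ B) (hy : ∀ b, |yv p b| ≤ B)
    (hκ : 0 ≤ κ) [Nonempty V]
    (hP : P2 T K) (h3 : ∀ α, 3 ≤ (T α).card) (hk : ∀ α, (T α).card ≤ k) {c : ι → ℝ}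
    (hc : ∀ α, |c α| ≤ κ / Fintype.card V) (hv : Ex p (fun x => poly T c p x ^ 2) = 1) (t : ℝ) :
    ‖Ex p (fun x => ce t (poly T c p x)) - ((Real.exp (-(t ^ 2) / 2) : ℝ) : ℂ)‖ ≤
      (((κ * B ^ k) ^ 4 * (72 * k ^ 7 * K ^ 4) + 1) * t ^ 2 +
        3 * B ^ 3 * (1 + 2 * ((κ * B ^ k) ^ 4 * (27 * k ^ 4 * K ^ 4))) * |t| ^ 3) /
          Real.sqrt (Fintype.card V) := by
  set n : ℝ := ((Fintype.card V : ℕ) : ℝ) with hn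
  have hn0 : 0 < n := by rw [hn]; exact_mod_cast Fintype.card_pos
  set r := Real.sqrt n with hr
  have hr0 : 0 < r := Real.sqrt_pos.2 hn0
  have hrn : r ^ 2 = n := Real.sq_sqrt hn0.le
  set b : ι → ℝ := fun α => c α / (T α).card with hbdef
  have hcard : ∀ α, (1 : ℝ) ≤ (T α).card := fun α => by
    have := h3 α; exact_mod_cast (by omega : 1 ≤ (T α).card)
  have hb : ∀ α, |b α| ≤ κ / n := fun α => by
    rw [hbdef]; simp only
    rw [abs_div, Nat.abs_cast]
    exact (div_le_self (abs_nonneg _) (hcard α)).trans (hc α)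
  have hW : ∀ x, poly T c p x = ∑ j, yv p (x j) * link T b p j x := by
    intro x
    rw [link_weighted, poly]
    refine Finset.sum_congr rfl fun α _ => ?_
    rw [hbdef]; simp only
    rw [div_mul_cancel₀]
    have := hcard α; positivity
  have hW0 : ∀ j, IndepOf j (fun x => ∑ α, if j ∈ T α then 0 else c α * mon p (T α) x) := by
    intro j x e
    refine Finset.sum_congr rfl fun α _ => ?_
    split_ifs with h
    · rfl
    · rw [mon_indep p _ j h]
  have hΓ := stein_var h0 h1 hW (poly_split c p) hW0 (link_indep b p) (link_indep c p)
  rw [hv] at hΓ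
  have hκn : 0 ≤ κ / n := by positivity
  have hvar := gam_var h0 h1 hB hy hκn hP h3 hk hb hc
  rw [← hΓ, ← hn] at hvar
  have hη₁ : Ex p (fun x => |∑ j, link T b p j x * link T c p j x - 1|) ≤
      ((κ * B ^ k) ^ 4 * (72 * k ^ 7 * K ^ 4) + 1) / r := by
    calc _ ≤ Ex p (fun x => r * (∑ j, link T b p j x * link T c p j x - 1) ^ 2 + 1 / r) := by
          refine Ex_mono h0.le h1.le fun x => ?_
          set f := ∑ j, link T b p j x * link T c p j x - 1
          rw [← sq_abs f]
          have : r * |f| ^ 2 + 1 / r - |f| = ((r * |f| - 1/2) ^ 2 + 3/4) / r := by field_simp; ring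
          have h2 : 0 ≤ ((r * |f| - 1/2) ^ 2 + 3/4) / r := by positivity
          linarith
      _ = r * Ex p (fun x => (∑ j, link T b p j x * link T c p j x - 1) ^ 2) + 1 / r := by
          rw [Ex_add, Ex_mul, Ex_const]
      _ ≤ r * ((κ / n * B ^ k) ^ 4 * (72 * k ^ 7 * K ^ 4) * n ^ 3) + 1 / r := by gcongr
      _ = _ := by rw [← hrn]; field_simp
  have hη₂ : ∑ j, Ex p (fun x => |link T b p j x| * link T c p j x ^ 2) ≤
      (1 + 2 * ((κ * B ^ k) ^ 4 * (27 * k ^ 4 * K ^ 4))) / r := by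
    have h2 : ∀ α, 2 ≤ (T α).card := fun α => le_trans (by norm_num) (h3 α)
    have : ∀ j, Ex p (fun x => |link T b p j x| * link T c p j x ^ 2) ≤
        (1 + 2 * ((κ * B ^ k) ^ 4 * (27 * k ^ 4 * K ^ 4))) / r ^ 3 := by
      intro j
      have l1 := link_four h0 h1 hB hy hκn hP h2 hk hb j
      have l2 := link_four h0 h1 hB hy hκn hP h2 hk hc j
      rw [← hn] at l1 l2
      calc _ ≤ Ex p (fun x => 1 / r ^ 3 + (r * link T b p j x ^ 4 + r * link T c p j x ^ 4)) := by
            refine Ex_mono h0.le h1.le fun x => ?_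
            set g := link T b p j x
            set d := link T c p j x
            have e : 1 / r ^ 3 + (r * g ^ 4 + r * d ^ 4) - |g| * d ^ 2 =
                (1 + (r * |g|) ^ 4 + (r * d) ^ 4 - (r * |g|) * (r * d) ^ 2) / r ^ 3 := by
              have : g ^ 4 = |g| ^ 4 := by rw [← abs_pow, abs_of_nonneg (by positivity)]
              rw [this]; field_simp; ring
            have : 0 ≤ (1 + (r * |g|) ^ 4 + (r * d) ^ 4 - (r * |g|) * (r * d) ^ 2) / r ^ 3 := by
              apply div_nonneg _ (by positivity)
              nlinarith [sq_nonneg ((r * |g|) ^ 2 - 1/2), sq_nonneg ((r * d) ^ 2 - (r * |g|))]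
            linarith
        _ = 1 / r ^ 3 + (r * Ex p (fun x => link T b p j x ^ 4) + r * Ex p (fun x => link T c p j x ^ 4)) := by
            rw [Ex_add, Ex_add, Ex_mul, Ex_mul, Ex_const]
        _ ≤ 1 / r ^ 3 + (r * ((κ / n * B ^ k) ^ 4 * (27 * k ^ 4 * K ^ 4) * n ^ 2) + r * ((κ / n * B ^ k) ^ 4 * (27 * k ^ 4 * K ^ 4) * n ^ 2)) := by gcongr
        _ = _ := by rw [← hrn]; field_simp; ring
    calc _ ≤ ∑ j : V, (1 + 2 * ((κ * B ^ k) ^ 4 * (27 * k ^ 4 * K ^ 4))) / r ^ 3 :=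
          Finset.sum_le_sum fun j _ => this j
      _ = n * ((1 + 2 * ((κ * B ^ k) ^ 4 * (27 * k ^ 4 * K ^ 4))) / r ^ 3) := by
          rw [Finset.sum_const, nsmul_eq_mul, Finset.card_univ]
      _ = _ := by rw [← hrn]; field_simp
  have := stein_clt h0 h1 hB hy hW (poly_split c p) hW0 (link_indep b p) (link_indep c p) hη₁ hη₂ t
  refine this.trans (le_of_eq ?_)
  field_simp

end GammaVar

open MeasureTheory ProbabilityTheory
open scoped ENNReal NNReal

noncomputable section Slice

def tcount {V : Type} [Fintype V] (x : V → Bool) : ℕ := (Finset.univ.filter fun i => x i = true).card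

def sl (V : Type) [Fintype V] [DecidableEq V] (L : ℕ) : Finset (V → Bool) :=
  Finset.univ.filter fun x => tcount x = L

def PL {V : Type} [Fintype V] [DecidableEq V] {E : Type} [AddCommGroup E] [Module ℝ E] (L : ℕ)
    (f : (V → Bool) → E) : E := ((sl V L).card : ℝ)⁻¹ • ∑ x ∈ sl V L, f x

variable {V : Type} [Fintype V] [DecidableEq V]

lemma mem_sl {L : ℕ} {x : V → Bool} : x ∈ sl V L ↔ tcount x = L := by simp [sl]

section
variable {E : Type} [AddCommGroup E] [Module ℝ E]

lemma PL_add (L : ℕ) (f g : (V → Bool) → E) : PL L (fun x => f x + g x) = PL L f + PL L g := by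
  simp [PL, Finset.sum_add_distrib]

lemma PL_sub (L : ℕ) (f g : (V → Bool) → E) : PL L (fun x => f x - g x) = PL L f - PL L g := by
  simp [PL, smul_sub]

lemma PL_sum {κ : Type} (s : Finset κ) (L : ℕ) (f : κ → (V → Bool) → E) :
    PL L (fun x => ∑ a ∈ s, f a x) = ∑ a ∈ s, PL L (f a) := by
  simp only [PL]
  rw [Finset.sum_comm, Finset.smul_sum]

lemma PL_smul (L : ℕ) (r : ℝ) (f : (V → Bool) → E) : PL L (fun x => r • f x) = r • PL L f := by
  simp only [PL]
  rw [← Finset.smul_sum, smul_comm]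

lemma PL_congr (L : ℕ) {f g : (V → Bool) → E} (h : ∀ x ∈ sl V L, f x = g x) : PL L f = PL L g := by
  simp only [PL]; rw [Finset.sum_congr rfl h]

lemma tcount_perm (π : Equiv.Perm V) (x : V → Bool) : tcount (fun i => x (π i)) = tcount x := by
  unfold tcount
  refine Finset.card_bij (fun i _ => π i) ?_ ?_ ?_
  · intro i hi; simpa using hi
  · intro i _ j _ h; exact π.injective h
  · intro j hj; exact ⟨π.symm j, by simpa using hj, by simp⟩

lemma PL_perm (L : ℕ) (π : Equiv.Perm V) (f : (V → Bool) → E) :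
    PL L (fun x => f (fun i => x (π i))) = PL L f := by
  simp only [PL]; congr 1
  refine Finset.sum_bij' (fun x _ => fun i => x (π i)) (fun x _ => fun i => x (π.symm i)) ?_ ?_ ?_ ?_ ?_
  · intro x hx; rw [mem_sl] at *; rw [tcount_perm, hx]
  · intro x hx; rw [mem_sl] at *; rw [tcount_perm, hx]
  · intro x hx; simp
  · intro x hx; simp
  · intro x hx; rfl
end

lemma PL_mul (L : ℕ) (r : ℝ) (f : (V → Bool) → ℝ) : PL L (fun x => r * f x) = r * PL L f :=
  PL_smul L r f

lemma PL_mono (L : ℕ) {f g : (V → Bool) → ℝ} (h : ∀ x ∈ sl V L, f x ≤ g x) : PL L f ≤ PL L g := by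
  simp only [PL, smul_eq_mul]
  exact mul_le_mul_of_nonneg_left (Finset.sum_le_sum h) (by positivity)

lemma norm_PL_le (L : ℕ) {E : Type} [NormedAddCommGroup E] [NormedSpace ℝ E] (f : (V → Bool) → E) :
    ‖PL L f‖ ≤ PL L (fun x => ‖f x‖) := by
  simp only [PL]
  rw [norm_smul, smul_eq_mul, Real.norm_of_nonneg (by positivity)]
  exact mul_le_mul_of_nonneg_left (norm_sum_le _ _) (by positivity)

lemma PL_const_le (L : ℕ) {M : ℝ} (hM : 0 ≤ M) : PL L (fun _ : V → Bool => M) ≤ M := by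
  simp only [PL, smul_eq_mul, Finset.sum_const, nsmul_eq_mul]
  rcases Nat.eq_zero_or_pos (sl V L).card with h | h
  · simp [h, hM]
  · have : (0:ℝ) < (sl V L).card := by exact_mod_cast h
    rw [inv_mul_cancel_left₀ this.ne']

lemma norm_PL_le' (L : ℕ) {E : Type} [NormedAddCommGroup E] [NormedSpace ℝ E] {f : (V → Bool) → E}
    {M : ℝ} (hM : 0 ≤ M) (h : ∀ x, ‖f x‖ ≤ M) : ‖PL L f‖ ≤ M :=
  (norm_PL_le L f).trans ((PL_mono L fun x _ => h x).trans (PL_const_le L hM))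

/-- value of the linear sum on the slice -/
def sv (V : Type) [Fintype V] (p : ℝ) (L : ℕ) : ℝ := (L - p * Fintype.card V) / Real.sqrt (p * (1 - p))

lemma sum_yv (p : ℝ) (x : V → Bool) : ∑ i, yv p (x i) = sv V p (tcount x) := by
  simp only [yv, sv, tcount]
  rw [← Finset.sum_div, Finset.sum_sub_distrib]
  simp; ring

def uu (V : Type) [Fintype V] (p : ℝ) (L : ℕ) : ℝ := 1 + |sv V p L| / Real.sqrt (Fintype.card V)

def rr (V : Type) [Fintype V] (p : ℝ) (L : ℕ) : ℝ := uu V p L / Real.sqrt (Fintype.card V)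

lemma one_le_uu (p : ℝ) (L : ℕ) : 1 ≤ uu V p L := by
  unfold uu; have : 0 ≤ |sv V p L| / Real.sqrt (Fintype.card V) := by positivity
  linarith

def DepOn (S : Finset V) (h : (V → Bool) → ℝ) : Prop := ∀ x y, (∀ i ∈ S, x i = y i) → h x = h y

def MB (B : ℝ) (a b : ℕ) (C : ℝ) : Prop :=
  0 ≤ C ∧ ∀ (V : Type) [Fintype V] [DecidableEq V] (p : ℝ), (∀ b, |yv p b| ≤ B) → ∀ (L : ℕ)
    (A S : Finset V) (h : (V → Bool) → ℝ) (H : ℝ), A.card = a → S.card ≤ b → Disjoint A S →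
    DepOn S h → (∀ x, |h x| ≤ H) → |PL L (fun x => mon p A x * h x)| ≤ C * rr V p L ^ a * H

lemma mon_dep (p : ℝ) (A : Finset V) : DepOn A (mon p A) := by
  intro x y h
  exact Finset.prod_congr rfl fun i hi => by rw [h i hi]

lemma PL_swap {p : ℝ} {j l : V} {A S : Finset V} {h : (V → Bool) → ℝ} (L : ℕ) (hj : j ∉ A) (hj' : j ∉ S)
    (hl : l ∉ A) (hl' : l ∉ S) (hh : DepOn S h) :
    PL L (fun x => yv p (x l) * (mon p A x * h x)) = PL L (fun x => yv p (x j) * (mon p A x * h x)) := by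
  rw [← PL_perm L (Equiv.swap j l)]
  refine PL_congr L fun x _ => ?_
  have hne : ∀ T : Finset V, j ∉ T → l ∉ T → ∀ i ∈ T, x (Equiv.swap j l i) = x i := by
    intro T h1 h2 i hi
    rw [Equiv.swap_apply_of_ne_of_ne] <;> rintro rfl <;> contradiction
  rw [mon_dep p A _ x (hne A hj hl), hh _ x (hne S hj' hl')]
  simp

lemma moment_id {p : ℝ} {j : V} {A S : Finset V} {h : (V → Bool) → ℝ} (L : ℕ) (hj : j ∉ A) (hj' : j ∉ S)
    (hd : Disjoint A S) (hh : DepOn S h) :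
    ((Fintype.card V : ℝ) - A.card - S.card) * PL L (fun x => yv p (x j) * (mon p A x * h x)) =
      sv V p L * PL L (fun x => mon p A x * h x)
      - ∑ l ∈ A, PL L (fun x => mon p (A.erase l) x * (yv p (x l) ^ 2 * h x))
      - ∑ l ∈ S, PL L (fun x => mon p A x * (yv p (x l) * h x)) := by
  have e1 : sv V p L * PL L (fun x => mon p A x * h x) =
      ∑ l, PL L (fun x => yv p (x l) * (mon p A x * h x)) := by
    rw [← PL_sum, ← PL_mul]
    refine PL_congr L fun x hx => ?_
    rw [← Finset.sum_mul, sum_yv, mem_sl.1 hx]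
  have e2 : ∑ l, PL L (fun x => yv p (x l) * (mon p A x * h x)) =
      ∑ l ∈ (A ∪ S)ᶜ, PL L (fun x => yv p (x l) * (mon p A x * h x)) +
      (∑ l ∈ A, PL L (fun x => yv p (x l) * (mon p A x * h x)) +
       ∑ l ∈ S, PL L (fun x => yv p (x l) * (mon p A x * h x))) := by
    rw [← Finset.sum_union hd, Finset.sum_compl_add_sum]
  have e3 : ∑ l ∈ (A ∪ S)ᶜ, PL L (fun x => yv p (x l) * (mon p A x * h x)) =
      ((Fintype.card V : ℝ) - A.card - S.card) * PL L (fun x => yv p (x j) * (mon p A x * h x)) := by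
    rw [Finset.sum_congr rfl (g := fun _ => PL L (fun x => yv p (x j) * (mon p A x * h x)))]
    · rw [Finset.sum_const, nsmul_eq_mul, Finset.card_compl, Nat.cast_sub (Finset.card_le_univ _),
        Finset.card_union_of_disjoint hd]
      push_cast; ring
    · intro l hl
      simp only [Finset.mem_compl, Finset.mem_union, not_or] at hl
      exact PL_swap L hj hj' hl.1 hl.2 hh
  have e4 : ∑ l ∈ A, PL L (fun x => yv p (x l) * (mon p A x * h x)) =
      ∑ l ∈ A, PL L (fun x => mon p (A.erase l) x * (yv p (x l) ^ 2 * h x)) := by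
    refine Finset.sum_congr rfl fun l hl => PL_congr L fun x _ => ?_
    rw [← mon_erase hl]; ring
  have e5 : ∑ l ∈ S, PL L (fun x => yv p (x l) * (mon p A x * h x)) =
      ∑ l ∈ S, PL L (fun x => mon p A x * (yv p (x l) * h x)) := by
    refine Finset.sum_congr rfl fun l hl => PL_congr L fun x _ => ?_
    ring
  rw [e1, e2, e3, e4, e5]; ring

end Slice

open MeasureTheory ProbabilityTheory
open scoped ENNReal NNReal

noncomputable section Moment
variable {V : Type} [Fintype V] [DecidableEq V]

lemma rr_facts (hn : 0 < Fintype.card V) (p : ℝ) (L : ℕ) :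
    0 < rr V p L ∧ 1 ≤ rr V p L * (Fintype.card V : ℝ) ∧ 1 ≤ rr V p L ^ 2 * (Fintype.card V : ℝ) ∧
      |sv V p L| ≤ rr V p L * (Fintype.card V : ℝ) := by
  have hu := one_le_uu (V := V) p L
  have hn1 : (1:ℝ) ≤ Fintype.card V := by exact_mod_cast hn
  set n : ℝ := ((Fintype.card V : ℕ) : ℝ) with hnd
  set R := Real.sqrt n with hR
  have hR1 : 1 ≤ R := Real.one_le_sqrt.2 hn1
  have hRn : R ^ 2 = n := Real.sq_sqrt (by linarith)
  have hr : rr V p L = uu V p L / R := rfl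
  have huu : uu V p L = 1 + |sv V p L| / R := rfl
  have e1 : rr V p L * n = uu V p L * R := by rw [hr, ← hRn]; field_simp
  refine ⟨by rw [hr]; positivity, ?_, ?_, ?_⟩
  · rw [e1]; nlinarith
  · rw [sq, mul_assoc, e1, hr]
    have : uu V p L / R * (uu V p L * R) = uu V p L ^ 2 := by field_simp
    rw [this]; nlinarith
  · rw [e1, huu]
    have : (1 + |sv V p L| / R) * R = R + |sv V p L| := by field_simp
    rw [this]; linarith

lemma mon_insert {p : ℝ} {A : Finset V} {j : V} (hj : j ∉ A) (x : V → Bool) :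
    mon p (insert j A) x = yv p (x j) * mon p A x := by
  rw [mon, mon, Finset.prod_insert hj]

lemma MB_zero (B : ℝ) (b : ℕ) : MB B 0 b 1 := by
  refine ⟨by norm_num, ?_⟩
  intro V _ _ p hy L A S h H hA hS hd hh hH
  have hA : A = ∅ := Finset.card_eq_zero.1 hA
  subst hA
  have h0 : 0 ≤ H := (abs_nonneg _).trans (hH fun _ => true)
  have := norm_PL_le' (f := h) L h0 hH
  simpa [mon] using this

lemma MB_succ {B : ℝ} (hB : 1 ≤ B) {a b : ℕ} {C1 C2 : ℝ} (h1 : MB B a b C1) (hC2 : 0 ≤ C2)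
    (h2 : a = 0 ∨ MB B (a - 1) (b + 1) C2) :
    MB B (a + 1) b (2 * (C1 + a * B ^ 2 * C2 + b * B * C1) + (B * (2 * (a + b) + 1)) ^ (a + 1)) := by
  have hC1 := h1.1
  refine ⟨by positivity, ?_⟩
  intro V _ _ p hy L A S h H hA hS hd hh hH
  have h0 : 0 ≤ H := (abs_nonneg _).trans (hH fun _ => true)
  obtain ⟨j, A, hj, hAe, hA2⟩ := Finset.card_eq_succ.1 hA
  subst hAe
  clear hA
  have hA := hA2
  rw [Finset.disjoint_insert_left] at hd
  obtain ⟨hjS, hd⟩ := hd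
  have hn : 0 < Fintype.card V := Fintype.card_pos_iff.2 ⟨j⟩
  obtain ⟨hr0, hr1, hr2, hr3⟩ := rr_facts hn p L
  set r := rr V p L with hrd
  by_cases hc : 2 * (a + b) ≤ Fintype.card V
  · have hcR : 2 * ((a:ℝ) + b) ≤ (Fintype.card V : ℝ) := by exact_mod_cast hc
    have hn1 : (0:ℝ) < Fintype.card V := by exact_mod_cast hn
    have hSb : (S.card : ℝ) ≤ b := by exact_mod_cast hS
    have id := moment_id (p := p) L hj hjS hd hh
    rw [hA] at id
    set n : ℝ := ((Fintype.card V : ℕ) : ℝ) with hnd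
    set M := PL L (fun x => yv p (x j) * (mon p A x * h x)) with hM
    have hMe : PL L (fun x => mon p (insert j A) x * h x) = M :=
      PL_congr L fun x _ => by rw [mon_insert hj]; ring
    rw [hMe]
    have b1 : |sv V p L * PL L (fun x => mon p A x * h x)| ≤ (r * n) * (C1 * r ^ a * H) := by
      rw [abs_mul]
      exact mul_le_mul hr3 (h1.2 V p hy L A S h H hA hS hd hh hH) (abs_nonneg _) (by positivity)
    have b2 : |∑ l ∈ A, PL L (fun x => mon p (A.erase l) x * (yv p (x l) ^ 2 * h x))| ≤
        (r * n) * (a * B ^ 2 * C2 * r ^ a * H) := by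
      rcases h2 with h2 | h2
      · have : A = ∅ := Finset.card_eq_zero.1 (hA.trans h2)
        subst this; simp only [Finset.sum_empty, abs_zero]; positivity
      · rcases Nat.eq_zero_or_pos a with h3 | h3
        · have : A = ∅ := Finset.card_eq_zero.1 (hA.trans h3)
          subst this; simp only [Finset.sum_empty, abs_zero]; positivity
        calc _ ≤ ∑ l ∈ A, |PL L (fun x => mon p (A.erase l) x * (yv p (x l) ^ 2 * h x))| :=
              Finset.abs_sum_le_sum_abs _ _
          _ ≤ ∑ l ∈ A, C2 * r ^ (a - 1) * (B ^ 2 * H) := by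
              refine Finset.sum_le_sum fun l hl => ?_
              refine h2.2 V p hy L (A.erase l) (insert l S) _ _ ?_ ?_ ?_ ?_ ?_
              · rw [Finset.card_erase_of_mem hl, hA]
              · exact (Finset.card_insert_le _ _).trans (by omega)
              · rw [Finset.disjoint_insert_right]
                exact ⟨Finset.notMem_erase _ _, Disjoint.mono_left (Finset.erase_subset _ _) hd⟩
              · intro x y hxy
                show yv p (x l) ^ 2 * h x = yv p (y l) ^ 2 * h y
                rw [hxy l (by simp), hh x y fun i hi => hxy i (by simp [hi])]
              · intro x
                rw [abs_mul, abs_pow]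
                exact mul_le_mul (pow_le_pow_left₀ (abs_nonneg _) (hy _) 2) (hH x) (abs_nonneg _) (by positivity)
          _ = a * B ^ 2 * C2 * r ^ (a - 1) * H := by
              rw [Finset.sum_const, hA, nsmul_eq_mul]; ring
          _ ≤ a * B ^ 2 * C2 * r ^ (a - 1) * H * (r ^ 2 * n) := le_mul_of_one_le_right (by positivity) hr2
          _ = _ := by
              obtain ⟨a', rfl⟩ := Nat.exists_eq_succ_of_ne_zero h3.ne'
              simp only [Nat.succ_eq_add_one, Nat.add_sub_cancel]
              ring
    have b3 : |∑ l ∈ S, PL L (fun x => mon p A x * (yv p (x l) * h x))| ≤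
        (r * n) * (b * B * C1 * r ^ a * H) := by
      calc _ ≤ ∑ l ∈ S, |PL L (fun x => mon p A x * (yv p (x l) * h x))| :=
              Finset.abs_sum_le_sum_abs _ _
          _ ≤ ∑ l ∈ S, C1 * r ^ a * (B * H) := by
              refine Finset.sum_le_sum fun l hl => ?_
              refine h1.2 V p hy L A S _ _ hA hS hd ?_ ?_
              · intro x y hxy
                show yv p (x l) * h x = yv p (y l) * h y
                rw [hxy l hl, hh x y hxy]
              · intro x
                rw [abs_mul]
                exact mul_le_mul (hy _) (hH x) (abs_nonneg _) (by positivity)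
          _ = S.card * (C1 * r ^ a * (B * H)) := by rw [Finset.sum_const, nsmul_eq_mul]
          _ ≤ b * (C1 * r ^ a * (B * H)) := by gcongr
          _ ≤ b * (C1 * r ^ a * (B * H)) * (r * n) := le_mul_of_one_le_right (by positivity) hr1
          _ = _ := by ring
    have hpos : n / 2 ≤ n - a - S.card := by linarith
    have key : (n / 2) * |M| ≤ (n / 2) * (2 * (C1 + a * B ^ 2 * C2 + b * B * C1) * r ^ (a + 1) * H) := by
      calc (n / 2) * |M| ≤ (n - a - S.card) * |M| := mul_le_mul_of_nonneg_right hpos (abs_nonneg _)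
        _ = |(n - a - S.card) * M| := by rw [abs_mul, abs_of_nonneg (a := n - a - S.card) (by linarith)]
        _ ≤ (r * n) * (C1 * r ^ a * H) + (r * n) * (a * B ^ 2 * C2 * r ^ a * H) + (r * n) * (b * B * C1 * r ^ a * H) := by
            rw [id]
            exact (abs_sub _ _).trans (add_le_add ((abs_sub _ _).trans (add_le_add b1 b2)) b3)
        _ = _ := by ring
    have := le_of_mul_le_mul_left key (by positivity)
    refine this.trans ?_
    gcongr
    have : 0 ≤ (B * (2 * ((a:ℝ) + b) + 1)) ^ (a + 1) := by positivity
    linarith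
  · have hb1 : |PL L (fun x => mon p (insert j A) x * h x)| ≤ B ^ (a + 1) * H := by
      rw [← Real.norm_eq_abs]
      have hpos : 0 ≤ B ^ (a + 1) * H := by positivity
      refine norm_PL_le' L hpos fun x => ?_
      rw [norm_mul]
      refine mul_le_mul (mon_abs_le hB hy ?_ x) (hH x) (norm_nonneg _) (by positivity)
      rw [Finset.card_insert_of_notMem hj, hA]
    refine hb1.trans ?_
    have hnle : (Fintype.card V : ℝ) ≤ 2 * (a + b) + 1 := by
      have : Fintype.card V ≤ 2 * (a + b) + 1 := by omega
      exact_mod_cast this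
    have h3 : 1 ≤ r * (2 * (a + b) + 1) := hr1.trans (by gcongr)
    have h4 : 1 ≤ (r * (2 * (a + b) + 1)) ^ (a + 1) := one_le_pow₀ h3
    have h5 : 0 ≤ 2 * (C1 + a * B ^ 2 * C2 + b * B * C1) * r ^ (a + 1) * H := by positivity
    calc B ^ (a + 1) * H ≤ B ^ (a + 1) * H * (r * (2 * (a + b) + 1)) ^ (a + 1) :=
          le_mul_of_one_le_right (by positivity) h4
      _ = (B * (2 * (a + b) + 1)) ^ (a + 1) * r ^ (a + 1) * H := by rw [mul_pow, mul_pow]; ring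
      _ ≤ _ := by rw [add_mul, add_mul]; linarith

lemma MB_exists {B : ℝ} (hB : 1 ≤ B) (a : ℕ) : ∀ b, ∃ C, MB B a b C := by
  induction a using Nat.strong_induction_on with
  | _ a ih =>
    intro b
    rcases a with _ | a
    · exact ⟨_, MB_zero B b⟩
    · obtain ⟨C1, h1⟩ := ih a (by omega) b
      rcases a with _ | a
      · exact ⟨_, MB_succ hB h1 le_rfl (Or.inl rfl)⟩
      · obtain ⟨C2, h2⟩ := ih a (by omega) (b + 1)
        exact ⟨_, MB_succ hB h1 h2.1 (Or.inr h2)⟩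

/-- pair weights -/
def pw (V : Type) [Fintype V] [DecidableEq V] (U U' : Finset V) : ℝ :=
  ((Fintype.card V : ℝ) ^ 2)⁻¹ + (if ∃ i ∈ U, i ∈ U' then (Fintype.card V : ℝ)⁻¹ else 0) +
    (if 2 ≤ (U' ∩ U).card then 1 else 0)

lemma rr_pow_le (hn : 0 < Fintype.card V) (p : ℝ) (L : ℕ) {d k : ℕ} {U U' : Finset V}
    (hU : 2 ≤ U.card) (hU' : 2 ≤ U'.card) (hUk : U.card ≤ k) (hUk' : U'.card ≤ k)
    (hd : d = (symmDiff U U').card) :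
    rr V p L ^ d ≤ uu V p L ^ (2 * k) * pw V U U' := by
  have hu := one_le_uu (V := V) p L
  have hn1 : (1:ℝ) ≤ Fintype.card V := by exact_mod_cast hn
  have hcard : d + 2 * (U' ∩ U).card = U.card + U'.card := by
    rw [hd, symmDiff_def, Finset.sup_eq_union, Finset.card_union_of_disjoint disjoint_sdiff_sdiff]
    have h1 := Finset.card_sdiff_add_card_inter U U'
    have h2 := Finset.card_sdiff_add_card_inter U' U
    rw [Finset.inter_comm U U'] at h1
    omega
  have hdk : d ≤ 2 * k := by omega
  unfold pw
  set n : ℝ := ((Fintype.card V : ℕ) : ℝ) with hnd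
  have hr : rr V p L = uu V p L / Real.sqrt n := rfl
  set R := Real.sqrt n with hR
  have hR1 : 1 ≤ R := Real.one_le_sqrt.2 hn1
  have hRn : R ^ 2 = n := Real.sq_sqrt (by linarith)
  rw [hr, div_pow, div_eq_mul_inv]
  refine mul_le_mul (pow_le_pow_right₀ hu hdk) ?_ (by positivity) (by positivity)
  have hinv : ∀ e, e ≤ d → (R ^ d)⁻¹ ≤ (R ^ e)⁻¹ := fun e he => by
    have := pow_le_pow_right₀ hR1 he
    gcongr
  have n0 : 0 ≤ (n ^ 2)⁻¹ := by positivity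
  have n1 : 0 ≤ n⁻¹ := by positivity
  by_cases c2 : 2 ≤ (U' ∩ U).card
  · have := hinv 0 (by omega)
    rw [if_pos c2]
    split_ifs
    all_goals simp at this; linarith
  · by_cases c1 : ∃ i ∈ U, i ∈ U'
    · have := hinv 2 (by omega)
      rw [if_neg c2, if_pos c1]
      rw [hRn] at this; linarith
    · have h0 : (U' ∩ U).card = 0 := by
        rw [Finset.card_eq_zero, Finset.eq_empty_iff_forall_notMem]
        intro i hi
        rw [Finset.mem_inter] at hi
        exact c1 ⟨i, hi.2, hi.1⟩
      have := hinv 4 (by omega)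
      rw [if_neg c2, if_neg c1]
      have e : R ^ 4 = n ^ 2 := by rw [← hRn]; ring
      rw [e] at this; linarith

lemma mon_mul_mon (p : ℝ) (U U' : Finset V) (x : V → Bool) :
    mon p U x * mon p U' x = mon p (symmDiff U U') x * (mon p (U ∩ U') x) ^ 2 := by
  have h1 : mon p U x = mon p (U \ U') x * mon p (U ∩ U') x := by
    simp only [mon]
    rw [← Finset.prod_union (Finset.disjoint_sdiff_inter _ _), Finset.sdiff_union_inter]
  have h2 : mon p U' x = mon p (U' \ U) x * mon p (U ∩ U') x := by
    simp only [mon]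
    rw [Finset.inter_comm, ← Finset.prod_union (Finset.disjoint_sdiff_inter _ _), Finset.sdiff_union_inter]
  have h3 : mon p (symmDiff U U') x = mon p (U \ U') x * mon p (U' \ U) x := by
    simp only [mon]
    rw [← Finset.prod_union disjoint_sdiff_sdiff]; rfl
  rw [h1, h2, h3]; ring

/-- pair moment bound, uniform constant -/
lemma pair_moment {B : ℝ} (hB : 1 ≤ B) (k : ℕ) : ∃ C : ℝ, 0 ≤ C ∧
    ∀ (V : Type) [Fintype V] [DecidableEq V] (p : ℝ), 0 < Fintype.card V → (∀ b, |yv p b| ≤ B) →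
    ∀ (L : ℕ) (U U' : Finset V), 2 ≤ U.card → 2 ≤ U'.card → U.card ≤ k → U'.card ≤ k →
    |PL L (fun x => mon p U x * mon p U' x)| ≤ C * uu V p L ^ (2 * k) * pw V U U' := by
  choose F hF using fun a => MB_exists hB a k
  refine ⟨(∑ a ∈ Finset.range (2 * k + 1), F a) * B ^ (2 * k), ?_, ?_⟩
  · exact mul_nonneg (Finset.sum_nonneg fun a _ => (hF a).1) (by positivity)
  intro V _ _ p hn hy L U U' hU hU' hUk hUk'
  have hd : (symmDiff U U').card ≤ 2 * k := by
    rw [symmDiff_def, Finset.sup_eq_union, Finset.card_union_of_disjoint disjoint_sdiff_sdiff]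
    have h1 := Finset.card_le_card (Finset.sdiff_subset (s := U) (t := U'))
    have h2 := Finset.card_le_card (Finset.sdiff_subset (s := U') (t := U))
    omega
  have hI : (U ∩ U').card ≤ k := (Finset.card_le_card Finset.inter_subset_left).trans hUk
  have := (hF (symmDiff U U').card).2 V p hy L (symmDiff U U') (U ∩ U') (fun x => mon p (U ∩ U') x ^ 2)
    (B ^ (2 * k)) rfl hI ?_ ?_ ?_
  · simp only [mon_mul_mon]
    have hr := rr_pow_le hn p L hU hU' hUk hUk' rfl
    have hr0 := (rr_facts hn p L).1
    have hle : F (symmDiff U U').card ≤ ∑ a ∈ Finset.range (2 * k + 1), F a :=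
      Finset.single_le_sum (f := F) (fun a _ => (hF a).1) (Finset.mem_range.2 (by omega))
    have hs : 0 ≤ ∑ a ∈ Finset.range (2 * k + 1), F a := Finset.sum_nonneg fun a _ => (hF a).1
    refine this.trans ?_
    calc _ ≤ (∑ a ∈ Finset.range (2 * k + 1), F a) * (uu V p L ^ (2 * k) * pw V U U') * B ^ (2 * k) := by
          gcongr
      _ = _ := by ring
  · rw [Finset.disjoint_left]
    intro i hi hi'
    simp only [Finset.mem_symmDiff, Finset.mem_inter] at hi hi'
    tauto
  · intro x y hxy
    simp only [mon_dep p (U ∩ U') x y hxy]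
  · intro x
    rw [abs_pow, pow_mul']
    exact pow_le_pow_left₀ (abs_nonneg _) (mon_abs_le hB hy hI x) 2

end Moment

open MeasureTheory ProbabilityTheory
open scoped ENNReal NNReal

noncomputable section Quad
variable {V ι : Type} [Fintype V] [DecidableEq V] [Fintype ι]

lemma sum_ite_cnt {α : Type} [Fintype α] (P : α → Prop) [DecidablePred P] (r : ℝ) :
    ∑ a, (if P a then r else 0) = cnt P * r := by
  rw [cnt_eq, ← Finset.sum_filter, Finset.sum_const, nsmul_eq_mul]

def PM (V : Type) [Fintype V] [DecidableEq V] (p : ℝ) (L k : ℕ) (D : ℝ) : Prop :=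
  0 ≤ D ∧ ∀ U U' : Finset V, 2 ≤ U.card → 2 ≤ U'.card → U.card ≤ k → U'.card ≤ k →
    |PL L (fun x => mon p U x * mon p U' x)| ≤ D * pw V U U'

lemma quad_le {p D β : ℝ} {L k N1 N2 N3 : ℕ} (hD : PM V p L k D) (hβ : 0 ≤ β)
    (U : ι → Finset V) (h2 : ∀ α, 2 ≤ (U α).card) (hk : ∀ α, (U α).card ≤ k) {b : ι → ℝ}
    (hb : ∀ α, |b α| ≤ β) (hN1 : cnt (fun _ : ι => True) ≤ N1)
    (hN2 : cnt (fun z : ι × ι => ∃ i ∈ U z.1, i ∈ U z.2) ≤ N2)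
    (hN3 : cnt (fun z : ι × ι => 2 ≤ (U z.2 ∩ U z.1).card) ≤ N3) :
    PL L (fun x => (∑ α, b α * mon p (U α) x) ^ 2) ≤ β ^ 2 * D *
      ((N1 : ℝ) ^ 2 * ((Fintype.card V : ℝ) ^ 2)⁻¹ + N2 * (Fintype.card V : ℝ)⁻¹ + N3) := by
  have hD0 := hD.1
  have e : (fun x => (∑ α, b α * mon p (U α) x) ^ 2) =
      fun x => ∑ z : ι × ι, (b z.1 * b z.2) * (mon p (U z.1) x * mon p (U z.2) x) := by
    ext x
    rw [sq, Finset.sum_mul_sum, Fintype.sum_prod_type]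
    exact Finset.sum_congr rfl fun _ _ => Finset.sum_congr rfl fun _ _ => by ring
  rw [e, PL_sum]
  calc _ ≤ ∑ z : ι × ι, β ^ 2 * D * pw V (U z.1) (U z.2) := by
        refine Finset.sum_le_sum fun z _ => ?_
        rw [PL_mul]
        refine (le_abs_self _).trans ?_
        rw [abs_mul, mul_assoc]
        refine mul_le_mul ?_ (hD.2 _ _ (h2 _) (h2 _) (hk _) (hk _)) (abs_nonneg _) (by positivity)
        rw [abs_mul, sq]
        exact mul_le_mul (hb _) (hb _) (abs_nonneg _) hβ
    _ = β ^ 2 * D * (((Fintype.card ι : ℝ) ^ 2) * ((Fintype.card V : ℝ) ^ 2)⁻¹ +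
        cnt (fun z : ι × ι => ∃ i ∈ U z.1, i ∈ U z.2) * (Fintype.card V : ℝ)⁻¹ +
        cnt (fun z : ι × ι => 2 ≤ (U z.2 ∩ U z.1).card) * 1) := by
        rw [← Finset.mul_sum]
        simp only [pw]
        rw [Finset.sum_add_distrib, Finset.sum_add_distrib]
        have s1 := sum_ite_cnt (fun z : ι × ι => ∃ i ∈ U z.1, i ∈ U z.2) ((Fintype.card V : ℝ)⁻¹)
        have s2 := sum_ite_cnt (fun z : ι × ι => 2 ≤ (U z.2 ∩ U z.1).card) 1
        rw [← s1, ← s2, Finset.sum_const, Finset.card_univ, Fintype.card_prod, nsmul_eq_mul]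
        push_cast; rw [← sq]
    _ ≤ _ := by
        rw [cnt_true] at hN1
        rw [mul_one]
        gcongr

lemma Qgen {T : ι → Finset V} {p D β : ℝ} {L k K : ℕ} (hn : 0 < Fintype.card V) (hD : PM V p L k D) (hβ : 0 ≤ β)
    (hP : P2 T K) (h2 : ∀ α, 2 ≤ (T α).card) (hk : ∀ α, (T α).card ≤ k) {b : ι → ℝ}
    (hb : ∀ α, |b α| ≤ β) :
    PL L (fun x => (∑ α, b α * mon p (T α) x) ^ 2) ≤
      β ^ 2 * D * ((Fintype.card V : ℝ) ^ 2 * (K ^ 2 * (1 + k + k ^ 2))) := by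
  have := quad_le hD hβ T h2 hk hb (hP.zero h2)
    (cnt_fib _ (fun _ => True) (fun _ _ _ => trivial) (hP.zero h2) fun a _ => hP.meet h2 (T a) (hk a))
    (cnt_fib _ (fun _ => True) (fun _ _ _ => trivial) (hP.zero h2) fun a _ => hP.two (T a) (hk a))
  refine this.trans (le_of_eq ?_)
  have : (Fintype.card V : ℝ) ≠ 0 := by exact_mod_cast hn.ne'
  push_cast
  field_simp

lemma cnt_inj {α β : Type} [Fintype α] [Fintype β] (f : α → β) (hf : Function.Injective f)
    {P : α → Prop} {Q : β → Prop} (h : ∀ a, P a → Q (f a)) : cnt P ≤ cnt Q := by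
  classical
  simp only [cnt_eq]
  refine Finset.card_le_card_of_injOn f ?_ hf.injOn
  intro a ha
  simp at ha ⊢
  exact h a ha

lemma sum_link_sq {T : ι → Finset V} {p D β : ℝ} {L k K : ℕ} (hn : 0 < Fintype.card V) (hD : PM V p L k D) (hβ : 0 ≤ β)
    (hP : P2 T K) (h3 : ∀ α, 3 ≤ (T α).card) (hk : ∀ α, (T α).card ≤ k) {c : ι → ℝ}
    (hc : ∀ α, |c α| ≤ β) :
    PL L (fun x => (∑ j, link T c p j x) ^ 2) ≤
      β ^ 2 * D * ((Fintype.card V : ℝ) ^ 2 * ((k * K) ^ 2 * (1 + k + k ^ 2))) := by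
  have hP' : P2 (fun z : {z : ι × V // z.2 ∈ T z.1} => (T z.1.1).erase z.1.2) (K * k) := by
    intro i j hij
    refine (cnt_inj (Q := fun z : ι × V => (i ∈ T z.1 ∧ j ∈ T z.1) ∧ z.2 ∈ T z.1) Subtype.val
      Subtype.val_injective ?_).trans ?_
    · rintro ⟨z, hz⟩ ⟨h1, h2⟩
      exact ⟨⟨Finset.mem_of_mem_erase h1, Finset.mem_of_mem_erase h2⟩, hz⟩
    · refine cnt_fib _ (fun α => i ∈ T α ∧ j ∈ T α) (fun a b h => h.1) (hP i j hij) fun α _ => ?_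
      refine (cnt_mono (Q := fun j => j ∈ T α) fun j h => h.2).trans ?_
      rw [cnt_mem]; exact hk α
  have := Qgen hn hD hβ hP' (fun z => by
      have := h3 z.1.1
      show 2 ≤ ((T z.1.1).erase z.1.2).card
      rw [Finset.card_erase_of_mem z.2]; omega)
    (fun z => (Finset.card_le_card (Finset.erase_subset _ _)).trans (hk _))
    (b := fun z => c z.1.1) (fun z => hc _)
  refine le_trans (le_of_eq ?_) (this.trans (le_of_eq ?_))
  · congr 1; ext x; congr 1
    simp only [link]
    rw [Finset.sum_comm, ← Fintype.sum_prod_type' (f := fun α j => if j ∈ T α then c α * mon p ((T α).erase j) x else 0)]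
    rw [← Finset.sum_filter, ← Finset.sum_subtype_eq_sum_filter]
    simp
  · push_cast; ring

lemma link_sq {T : ι → Finset V} {p D β : ℝ} {L k K : ℕ} (hn : 0 < Fintype.card V) (hD : PM V p L k D) (hβ : 0 ≤ β)
    (hP : P2 T K) (h3 : ∀ α, 3 ≤ (T α).card) (hk : ∀ α, (T α).card ≤ k) {c : ι → ℝ}
    (hc : ∀ α, |c α| ≤ β) (j : V) :
    PL L (fun x => link T c p j x ^ 2) ≤
      β ^ 2 * D * ((Fintype.card V : ℝ) * (K ^ 2 * (1 + 2 * k ^ 2))) := by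
  have h2 : ∀ α, 2 ≤ (T α).card := fun α => le_trans (by norm_num) (h3 α)
  have hone : cnt (fun _ : {α // j ∈ T α} => True) ≤ Fintype.card V * K :=
    (cnt_inj (Q := fun α => j ∈ T α) Subtype.val Subtype.val_injective fun z _ => z.2).trans (hP.one h2 j)
  have htwo : ∀ a : {α // j ∈ T α}, cnt (fun a' : {α // j ∈ T α} => 2 ≤ (T a'.1 ∩ T a.1).card) ≤ k ^ 2 * K :=
    fun a => (cnt_inj (Q := fun α => 2 ≤ (T α ∩ T a.1).card) Subtype.val Subtype.val_injective
      fun z h => h).trans (hP.two _ (hk _))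
  have := quad_le hD hβ (fun z : {α // j ∈ T α} => (T z.1).erase j) (fun z => by
      have := h3 z.1
      show 2 ≤ ((T z.1).erase j).card
      rw [Finset.card_erase_of_mem z.2]; omega)
    (fun z => (Finset.card_le_card (Finset.erase_subset _ _)).trans (hk _))
    (b := fun z => c z.1) (fun z => hc _) hone
    (cnt_fib _ (fun _ => True) (fun _ _ _ => trivial) hone fun a _ => (cnt_mono (by
      rintro ⟨a', ha'⟩ ⟨i, hi, hi'⟩
      simp only [Finset.mem_erase] at hi hi'
      exact two_le_inter hi.1 hi'.2 ha' hi.2 a.2)).trans (htwo a))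
    (cnt_fib _ (fun _ => True) (fun _ _ _ => trivial) hone fun a _ => (cnt_mono (by
      rintro ⟨a', ha'⟩ h
      exact h.trans (Finset.card_le_card (Finset.inter_subset_inter (Finset.erase_subset _ _) (Finset.erase_subset _ _))))).trans (htwo a))
  have hD0 := hD.1
  have hn1 : (1:ℝ) ≤ Fintype.card V := by exact_mod_cast hn
  refine le_trans (le_of_eq ?_) (this.trans ?_)
  · congr 1; ext x; congr 1
    simp only [link]
    rw [← Finset.sum_filter, ← Finset.sum_subtype_eq_sum_filter]
    simp
  · push_cast
    set n : ℝ := ((Fintype.card V : ℕ) : ℝ)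
    have e : (n * (K:ℝ)) ^ 2 * (n ^ 2)⁻¹ + n * K * (k ^ 2 * K) * n⁻¹ + n * K * (k ^ 2 * K) =
        K ^ 2 + k ^ 2 * K ^ 2 + n * (k ^ 2 * K ^ 2) := by field_simp
    rw [e]
    have h1 : (K:ℝ) ^ 2 ≤ n * K ^ 2 := le_mul_of_one_le_left (by positivity) hn1
    have h2 : (k:ℝ) ^ 2 * K ^ 2 ≤ n * (k ^ 2 * K ^ 2) := le_mul_of_one_le_left (by positivity) hn1
    gcongr
    linarith

/-- combined quadratic bound -/
lemma slice_quad {T : ι → Finset V} {p D κ : ℝ} {L k K : ℕ} (hn : 0 < Fintype.card V) (hD : PM V p L k D) (hκ : 0 ≤ κ)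
    (hP : P2 T K) (h3 : ∀ α, 3 ≤ (T α).card) (hk : ∀ α, (T α).card ≤ k) {c : ι → ℝ}
    (hc : ∀ α, |c α| ≤ κ / Fintype.card V) :
    PL L (fun x => (∑ j, yv p (x j) * link T c p j x) ^ 2) ≤ κ ^ 2 * k ^ 2 * K ^ 2 * (1 + k + k ^ 2) * D ∧
    PL L (fun x => (∑ j, link T c p j x) ^ 2) ≤ κ ^ 2 * k ^ 2 * K ^ 2 * (1 + k + k ^ 2) * D ∧
    PL L (fun x => ∑ j, link T c p j x ^ 2) ≤ κ ^ 2 * K ^ 2 * (1 + 2 * k ^ 2) * D := by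
  have hn1 : (0:ℝ) < Fintype.card V := by exact_mod_cast hn
  have h2 : ∀ α, 2 ≤ (T α).card := fun α => le_trans (by norm_num) (h3 α)
  refine ⟨?_, ?_, ?_⟩
  · have := Qgen hn hD (β := k * (κ / Fintype.card V)) (by positivity) hP h2 hk
      (b := fun α => c α * (T α).card) (fun α => by
        rw [abs_mul, mul_comm, Nat.abs_cast]
        exact mul_le_mul (by exact_mod_cast hk α) (hc α) (abs_nonneg _) (by positivity))
    simp only [link_weighted]
    refine this.trans (le_of_eq ?_)
    field_simp
  · refine (sum_link_sq hn hD (by positivity) hP h3 hk hc).trans (le_of_eq ?_)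
    field_simp
  · rw [PL_sum]
    calc _ ≤ ∑ j : V, (κ / Fintype.card V) ^ 2 * D * ((Fintype.card V : ℝ) * (K ^ 2 * (1 + 2 * k ^ 2))) :=
          Finset.sum_le_sum fun j _ => link_sq hn hD (by positivity) hP h3 hk hc j
      _ = _ := by
          rw [Finset.sum_const, Finset.card_univ, nsmul_eq_mul]
          field_simp

end Quad

open MeasureTheory ProbabilityTheory
open scoped ENNReal NNReal

noncomputable section Step
variable {V ι : Type} [Fintype V] [DecidableEq V] [Fintype ι]

lemma tcount_up {x : V → Bool} {j : V} (hj : x j = false) :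
    tcount (Function.update x j true) = tcount x + 1 := by
  unfold tcount
  have : (Finset.univ.filter fun i => Function.update x j true i = true) =
      insert j (Finset.univ.filter fun i => x i = true) := by
    ext i
    by_cases h : i = j
    · subst h; simp
    · simp [Function.update_of_ne h, h]
  rw [this, Finset.card_insert_of_notMem (by simp [hj])]

lemma tcount_down {x : V → Bool} {j : V} (hj : x j = true) :
    tcount (Function.update x j false) + 1 = tcount x := by
  rw [← tcount_up (x := Function.update x j false) (j := j) (by simp)]
  congr 1
  rw [Function.update_idem, ← hj, Function.update_eq_self]

def Fs (x : V → Bool) : Finset V := Finset.univ.filter fun j => x j = false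

lemma card_Fs (x : V → Bool) : ((Fs x).card : ℝ) = Fintype.card V - tcount x := by
  have := Finset.card_filter_add_card_filter_not (s := (Finset.univ : Finset V)) (fun j => x j = true)
  simp only [Bool.not_eq_true] at this
  unfold Fs tcount
  rw [Finset.card_univ] at this
  rw [← this]; push_cast; ring

section
variable {E : Type} [AddCommGroup E] [Module ℝ E]

lemma sum_up (L : ℕ) (f : (V → Bool) → E) :
    ((L : ℝ) + 1) • ∑ y ∈ sl V (L + 1), f y =
      ∑ x ∈ sl V L, ∑ j ∈ Fs x, f (Function.update x j true) := by
  have h1 : ((L : ℝ) + 1) • ∑ y ∈ sl V (L + 1), f y =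
      ∑ y ∈ sl V (L + 1), ∑ j ∈ Finset.univ.filter (fun j => y j = true), f y := by
    rw [Finset.smul_sum]
    refine Finset.sum_congr rfl fun y hy => ?_
    have hy' : (Finset.univ.filter (fun j => y j = true)).card = L + 1 := mem_sl.1 hy
    rw [Finset.sum_const, hy', ← Nat.cast_smul_eq_nsmul ℝ]
    push_cast; rfl
  rw [h1, Finset.sum_sigma', Finset.sum_sigma']
  refine Finset.sum_bij' (fun z _ => ⟨Function.update z.1 z.2 false, z.2⟩)
    (fun z _ => ⟨Function.update z.1 z.2 true, z.2⟩) ?_ ?_ ?_ ?_ ?_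
  · rintro ⟨y, j⟩ h
    simp only [Finset.mem_sigma, mem_sl, Finset.mem_filter, Finset.mem_univ, true_and, Fs] at h ⊢
    have := tcount_down h.2
    exact ⟨by omega, by simp⟩
  · rintro ⟨y, j⟩ h
    simp only [Finset.mem_sigma, mem_sl, Finset.mem_filter, Finset.mem_univ, true_and, Fs] at h ⊢
    exact ⟨by rw [tcount_up h.2, h.1], by simp⟩
  · rintro ⟨y, j⟩ h
    simp only [Finset.mem_sigma, mem_sl, Finset.mem_filter, Finset.mem_univ, true_and, Fs] at h ⊢
    simp only [Function.update_idem]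
    rw [← h.2, Function.update_eq_self]
  · rintro ⟨y, j⟩ h
    simp only [Finset.mem_sigma, mem_sl, Finset.mem_filter, Finset.mem_univ, true_and, Fs] at h ⊢
    simp only [Function.update_idem]
    rw [← h.2, Function.update_eq_self]
  · rintro ⟨y, j⟩ h
    simp only [Finset.mem_sigma, mem_sl, Finset.mem_filter, Finset.mem_univ, true_and, Fs] at h ⊢
    simp only [Function.update_idem]
    rw [← h.2, Function.update_eq_self]

lemma card_up (L : ℕ) : ((L : ℝ) + 1) * (sl V (L + 1)).card = (sl V L).card * ((Fintype.card V : ℝ) - L) := by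
  have := sum_up (V := V) L (fun _ => (1 : ℝ))
  simp only [Finset.sum_const, nsmul_eq_mul, mul_one, smul_eq_mul] at this
  rw [this, Finset.sum_congr rfl (g := fun _ => (Fintype.card V : ℝ) - L)]
  · rw [Finset.sum_const, nsmul_eq_mul]
  · intro x hx; rw [card_Fs, mem_sl.1 hx]

lemma PL_up (L : ℕ) (hL : L < Fintype.card V) (f : (V → Bool) → E) :
    PL (L + 1) f - PL L f = ((Fintype.card V : ℝ) - L)⁻¹ •
      PL L (fun x => ∑ j ∈ Fs x, (f (Function.update x j true) - f x)) := by
  have hLn : (0:ℝ) < (Fintype.card V : ℝ) - L := by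
    have : (L:ℝ) < Fintype.card V := by exact_mod_cast hL
    linarith
  have e1 : PL (L + 1) f = ((Fintype.card V : ℝ) - L)⁻¹ • PL L (fun x => ∑ j ∈ Fs x, f (Function.update x j true)) := by
    simp only [PL]
    rw [← sum_up, smul_smul, smul_smul]
    congr 1
    have h := card_up (V := V) L
    have hL1 : ((L:ℝ) + 1) ≠ 0 := by positivity
    rw [← mul_inv, mul_comm ((Fintype.card V : ℝ) - L), ← h, mul_inv]
    field_simp
  have e2 : PL L f = ((Fintype.card V : ℝ) - L)⁻¹ • PL L (fun x => ∑ j ∈ Fs x, f x) := by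
    rw [← PL_smul]
    refine PL_congr L fun x hx => ?_
    rw [Finset.sum_const, ← Nat.cast_smul_eq_nsmul ℝ, card_Fs, mem_sl.1 hx, smul_smul,
      inv_mul_cancel₀ hLn.ne', one_smul]
  rw [e1, e2]
  rw [← smul_sub, ← PL_sub]
  simp only [Finset.sum_sub_distrib]
end

lemma poly_up {T : ι → Finset V} (c : ι → ℝ) (p : ℝ) {x : V → Bool} {j : V} (hj : x j = false) :
    poly T c p (Function.update x j true) = poly T c p x + (1 / Real.sqrt (p * (1 - p))) * link T c p j x := by
  have hy : yv p true = yv p false + 1 / Real.sqrt (p * (1 - p)) := by simp [yv]; ring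
  rw [poly_split c p j, poly_split c p j x, link_indep c p j x true, hj, Function.update_self, hy]
  have : (∑ α, if j ∈ T α then 0 else c α * mon p (T α) (Function.update x j true)) =
      ∑ α, if j ∈ T α then 0 else c α * mon p (T α) x := by
    refine Finset.sum_congr rfl fun α _ => ?_
    split_ifs with h
    · rfl
    · rw [mon_indep p _ j h]
  rw [this]; ring

lemma sum_Fs {p : ℝ} (h0 : 0 < p) (h1 : p < 1) (x : V → Bool) (g : V → ℝ) :
    ∑ j ∈ Fs x, (1 / Real.sqrt (p * (1 - p))) * g j =
      (1 / Real.sqrt (p * (1 - p))) * (1 - p) * ∑ j, g j - ∑ j, yv p (x j) * g j := by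
  have hs := s_pos h0 h1
  rw [Fs, Finset.sum_filter, Finset.mul_sum, ← Finset.sum_sub_distrib]
  refine Finset.sum_congr rfl fun j _ => ?_
  cases h : x j <;> simp [yv] <;> field_simp <;> ring

lemma rho_le {p B : ℝ} (h0 : 0 < p) (h1 : p < 1) (hy : ∀ b, |yv p b| ≤ B) :
    1 / Real.sqrt (p * (1 - p)) ≤ 2 * B := by
  have e : 1 / Real.sqrt (p * (1 - p)) = yv p true - yv p false := by simp [yv]; ring
  have a := abs_le.1 (hy true)
  have b := abs_le.1 (hy false)
  rw [e]; linarith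

lemma point_bound {T : ι → Finset V} {p B : ℝ} (h0 : 0 < p) (h1 : p < 1) (hy : ∀ b, |yv p b| ≤ B)
    (c : ι → ℝ) (t : ℝ) (x : V → Bool) :
    ‖∑ j ∈ Fs x, (ce t (poly T c p (Function.update x j true)) - ce t (poly T c p x))‖ ≤
      |t| * ((2 * B) * (1 + (∑ j, link T c p j x) ^ 2) + (1 + (∑ j, yv p (x j) * link T c p j x) ^ 2)) +
      8 * B ^ 2 * t ^ 2 * ∑ j, link T c p j x ^ 2 := by
  have hρ := rho_le h0 h1 hy
  have hs := s_pos h0 h1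
  set ρ := 1 / Real.sqrt (p * (1 - p)) with hρd
  have hρ0 : 0 < ρ := by positivity
  have hB0 : 0 < 2 * B := hρ0.trans_le hρ
  have e : ∑ j ∈ Fs x, (ce t (poly T c p (Function.update x j true)) - ce t (poly T c p x)) =
      ce t (poly T c p x) * (∑ j ∈ Fs x, (ce t (ρ * link T c p j x) - 1 - Complex.I * ((t * (ρ * link T c p j x) : ℝ) : ℂ))
        + Complex.I * ((t * ∑ j ∈ Fs x, ρ * link T c p j x : ℝ) : ℂ)) := by
    have : Complex.I * ((t * ∑ j ∈ Fs x, ρ * link T c p j x : ℝ) : ℂ) =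
        ∑ j ∈ Fs x, Complex.I * ((t * (ρ * link T c p j x) : ℝ) : ℂ) := by
      rw [Finset.mul_sum, Complex.ofReal_sum, Finset.mul_sum]
    rw [this, ← Finset.sum_add_distrib, Finset.mul_sum]
    refine Finset.sum_congr rfl fun j hj => ?_
    have hj : x j = false := by simpa [Fs] using hj
    rw [poly_up c p hj, ce_add]; ring
  rw [e, norm_mul, ce_norm, one_mul]
  refine (norm_add_le _ _).trans ?_
  rw [add_comm]
  refine add_le_add ?_ ?_
  · rw [norm_mul, Complex.norm_I, one_mul, Complex.norm_real, Real.norm_eq_abs, abs_mul]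
    refine mul_le_mul_of_nonneg_left ?_ (abs_nonneg t)
    rw [sum_Fs h0 h1]
    have hz : ∀ z : ℝ, |z| ≤ 1 + z ^ 2 := fun z => by
      rw [← sq_abs]; nlinarith [sq_nonneg (|z| - 1/2)]
    refine (abs_sub _ _).trans (add_le_add ?_ (hz _))
    rw [abs_mul, abs_of_pos (by rw [← hρd]; nlinarith)]
    refine mul_le_mul ?_ (hz _) (abs_nonneg _) hB0.le
    rw [← hρd]; nlinarith
  · calc _ ≤ ∑ j ∈ Fs x, 2 * (t ^ 2 * (ρ * link T c p j x) ^ 2) :=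
          norm_sum_le_of_le _ fun j _ => ce_sub_two _ _
      _ ≤ ∑ j, 2 * (t ^ 2 * (ρ * link T c p j x) ^ 2) :=
          Finset.sum_le_sum_of_subset_of_nonneg (Finset.subset_univ _) fun j _ _ => by positivity
      _ = 2 * t ^ 2 * ρ ^ 2 * ∑ j, link T c p j x ^ 2 := by
          rw [Finset.mul_sum]; exact Finset.sum_congr rfl fun j _ => by ring
      _ ≤ 2 * t ^ 2 * (2 * B) ^ 2 * ∑ j, link T c p j x ^ 2 := by
          have : 0 ≤ ∑ j, link T c p j x ^ 2 := Finset.sum_nonneg fun j _ => sq_nonneg _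
          gcongr
      _ = _ := by ring

def EE (κ : ℝ) (k K : ℕ) : ℝ := κ ^ 2 * k ^ 2 * K ^ 2 * (1 + k + k ^ 2) + κ ^ 2 * K ^ 2 * (1 + 2 * k ^ 2)

lemma step_bound {T : ι → Finset V} {p D κ B : ℝ} {L k K : ℕ} (h0 : 0 < p) (h1 : p < 1) (hB : 1 ≤ B)
    (hy : ∀ b, |yv p b| ≤ B) (hL : L < Fintype.card V) (hD : PM V p L k D) (hD1 : 1 ≤ D) (hκ : 0 ≤ κ)
    (hP : P2 T K) (h3 : ∀ α, 3 ≤ (T α).card) (hk : ∀ α, (T α).card ≤ k) {c : ι → ℝ}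
    (hc : ∀ α, |c α| ≤ κ / Fintype.card V) (t : ℝ) :
    ‖PL (L + 1) (fun x => ce t (poly T c p x)) - PL L (fun x => ce t (poly T c p x))‖ ≤
      ((Fintype.card V : ℝ) - L)⁻¹ * ((8 * B ^ 2 + 2 * B + 1) * (1 + EE κ k K) * (|t| + t ^ 2) * D) := by
  have hLn : (0:ℝ) < (Fintype.card V : ℝ) - L := by
    have : (L:ℝ) < Fintype.card V := by exact_mod_cast hL
    linarith
  obtain ⟨q1, q2, q3⟩ := slice_quad (by omega) hD hκ hP h3 hk hc
  rw [PL_up L hL, norm_smul, Real.norm_of_nonneg (by positivity)]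
  refine mul_le_mul_of_nonneg_left ?_ (by positivity)
  refine (norm_PL_le L _).trans ((PL_mono L fun x _ => point_bound h0 h1 hy c t x).trans ?_)
  have hE1 : κ ^ 2 * k ^ 2 * K ^ 2 * (1 + k + k ^ 2) ≤ EE κ k K := by unfold EE; have : 0 ≤ κ ^ 2 * (K:ℝ) ^ 2 * (1 + 2 * k ^ 2) := by positivity
                                                                      linarith
  have hE2 : κ ^ 2 * K ^ 2 * (1 + 2 * k ^ 2) ≤ EE κ k K := by unfold EE; have : 0 ≤ κ ^ 2 * (k:ℝ) ^ 2 * K ^ 2 * (1 + k + k ^ 2) := by positivity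
                                                              linarith
  have hE0 : 0 ≤ EE κ k K := by unfold EE; positivity
  have c1 := PL_const_le (V := V) L (M := 1) (by norm_num)
  rw [PL_add, PL_mul, PL_mul, PL_add, PL_mul, PL_add, PL_add]
  set Q1 := PL L (fun x => (∑ j, yv p (x j) * link T c p j x) ^ 2)
  set Q2 := PL L (fun x => (∑ j, link T c p j x) ^ 2)
  set Q3 := PL L (fun x => ∑ j, link T c p j x ^ 2)
  set O := PL L (fun _ : V → Bool => (1:ℝ))
  have hEq1 : Q1 ≤ EE κ k K * D := q1.trans (by gcongr)
  have hEq2 : Q2 ≤ EE κ k K * D := q2.trans (by gcongr)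
  have hEq3 : Q3 ≤ EE κ k K * D := q3.trans (by gcongr)
  have r1 : O + Q1 ≤ (1 + EE κ k K) * D := by linarith
  have r2 : O + Q2 ≤ (1 + EE κ k K) * D := by linarith
  have r3 : Q3 ≤ (1 + EE κ k K) * D := by linarith
  have hZ : 0 ≤ (1 + EE κ k K) * D := by positivity
  set Z := (1 + EE κ k K) * D
  calc _ ≤ |t| * (2 * B * Z + Z) + 8 * B ^ 2 * t ^ 2 * Z := by gcongr
    _ = (2 * B + 1) * (|t| * Z) + 8 * B ^ 2 * (t ^ 2 * Z) := by ring
    _ ≤ (8 * B ^ 2 + 2 * B + 1) * (|t| * Z) + (8 * B ^ 2 + 2 * B + 1) * (t ^ 2 * Z) := by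
        gcongr
        · nlinarith
        · linarith
    _ = _ := by ring

end Step

open MeasureTheory ProbabilityTheory
open scoped ENNReal NNReal

noncomputable section Transfer
variable {V ι : Type} [Fintype V] [DecidableEq V] [Fintype ι]

lemma s_le_one {p : ℝ} : Real.sqrt (p * (1 - p)) ≤ 1 := by
  rw [Real.sqrt_le_one]
  nlinarith [sq_nonneg (p - 1/2)]

lemma poly_le {T : ι → Finset V} {p κ B : ℝ} {k K : ℕ} (hn : 0 < Fintype.card V) (hB : 1 ≤ B)
    (hy : ∀ b, |yv p b| ≤ B) (hκ : 0 ≤ κ)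
    (hP : P2 T K) (h3 : ∀ α, 3 ≤ (T α).card) (hk : ∀ α, (T α).card ≤ k) {c : ι → ℝ}
    (hc : ∀ α, |c α| ≤ κ / Fintype.card V) (x : V → Bool) :
    |poly T c p x| ≤ κ * B ^ k * K * Fintype.card V := by
  have hn1 : (0:ℝ) < Fintype.card V := by exact_mod_cast hn
  have h2 : ∀ α, 2 ≤ (T α).card := fun α => le_trans (by norm_num) (h3 α)
  have := sum_le_cnt (fun _ : ι => True) (fun α => c α * mon p (T α) x) (M := κ / Fintype.card V * B ^ k)
    (by simp) (fun α => by
      rw [abs_mul]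
      exact mul_le_mul (hc α) (mon_abs_le hB hy (hk α) x) (abs_nonneg _) (by positivity))
  refine this.trans ?_
  have h := hP.zero h2
  have h' : (cnt (fun _ : ι => True) : ℝ) ≤ Fintype.card V * (Fintype.card V * K) := by exact_mod_cast h
  calc _ ≤ κ / Fintype.card V * B ^ k * (Fintype.card V * (Fintype.card V * K)) := by gcongr
    _ = _ := by field_simp

set_option maxHeartbeats 1000000 in
lemma chain_bound {T : ι → Finset V} {p κ B C lam : ℝ} {k K m N : ℕ} (hl : 0 < lam) (h0 : 0 < p) (h1 : p < 1 - lam)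
    (hB : 1 ≤ B) (hk1 : 1 ≤ k)
    (hn : 0 < Fintype.card V) (hp : p * Fintype.card V = m)
    (hy : ∀ b, |yv p b| ≤ B) (hC : 0 ≤ C)
    (hPM : ∀ L, PM V p L k (C * uu V p L ^ (2 * k))) (hκ : 0 ≤ κ)
    (hP : P2 T K) (h3 : ∀ α, 3 ≤ (T α).card) (hk : ∀ α, (T α).card ≤ k) {c : ι → ℝ}
    (hc : ∀ α, |c α| ≤ κ / Fintype.card V) (t : ℝ) (hN : N ≤ Fintype.card V) :
    ‖PL m (fun x => ce t (poly T c p x)) - PL N (fun x => ce t (poly T c p x))‖ ≤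
      (2 / lam * ((8 * B ^ 2 + 2 * B + 1) * (1 + EE κ k K) * (C + 1)) + 2 * (κ * B ^ k * K) * (2 / lam) ^ 3) *
       (|t| + t ^ 2) * uu V p N ^ (2 * k + 1) / Real.sqrt (Fintype.card V) := by
  have hp1 : p < 1 := by linarith
  have hE0 : 0 ≤ EE κ k K := by unfold EE; positivity
  have hs := s_pos h0 hp1
  have hs1 := s_le_one (p := p)
  have hn1 : (1:ℝ) ≤ Fintype.card V := by exact_mod_cast hn
  have hu1 := one_le_uu (V := V) p N
  have hsv : ∀ L, |sv V p L| = |(L:ℝ) - m| / Real.sqrt (p * (1 - p)) := fun L => by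
    rw [sv, hp, abs_div, abs_of_pos hs]
  have hud : ∀ L, uu V p L = 1 + |sv V p L| / Real.sqrt (Fintype.card V) := fun L => rfl
  have hDl : (|(N:ℝ) - m|) ≤ |sv V p N| := by
    rw [hsv]; exact le_div_self (abs_nonneg _) hs hs1
  set n : ℝ := ((Fintype.card V : ℕ) : ℝ) with hnd
  set R := Real.sqrt n with hR
  have hR1 : 1 ≤ R := Real.one_le_sqrt.2 hn1
  have hRn : R ^ 2 = n := Real.sq_sqrt (by linarith)
  set u := uu V p N with hu
  have hsvu : |sv V p N| ≤ R * u := by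
    rw [hu, hud]; have : R * (1 + |sv V p N| / R) = R + |sv V p N| := by field_simp
    linarith
  set C6 := (8 * B ^ 2 + 2 * B + 1) * (1 + EE κ k K) with hC6
  have hC60 : 0 ≤ C6 := by positivity
  set τ := |t| + t ^ 2 with hτ
  have hτ0 : 0 ≤ τ := by positivity
  by_cases hc' : |(N:ℝ) - m| ≤ lam * n / 2
  · set f : ℕ → ℂ := fun L => PL L (fun x => ce t (poly T c p x)) with hf
    set M := 2 / (lam * n) * (C6 * τ * ((C + 1) * u ^ (2 * k))) with hM
    have hstep : ∀ L, min m N ≤ L → L < max m N → dist (f L) (f (L + 1)) ≤ M := by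
      intro L hL1 hL2
      have hLN : |(L:ℝ) - m| ≤ |(N:ℝ) - m| := by
        rcases le_total m N with h | h
        · rw [min_eq_left h] at hL1; rw [max_eq_right h] at hL2
          have a1 : (m:ℝ) ≤ L := by exact_mod_cast hL1
          have a2 : (L:ℝ) ≤ N := by exact_mod_cast hL2.le
          rw [abs_of_nonneg (by linarith), abs_of_nonneg (by linarith)]; linarith
        · rw [min_eq_right h] at hL1; rw [max_eq_left h] at hL2
          have a1 : (N:ℝ) ≤ L := by exact_mod_cast hL1
          have a2 : (L:ℝ) ≤ m := by exact_mod_cast hL2.le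
          rw [abs_of_nonpos (by linarith), abs_of_nonpos (by linarith)]; linarith
      have huL : uu V p L ≤ u := by
        rw [hu, hud, hud, hsv, hsv]; gcongr
      have hge : lam * n / 2 ≤ n - L := by
        have := (abs_le.1 (hLN.trans hc')).2
        have h5 : p * n ≤ (1 - lam) * n := by gcongr
        rw [hp] at h5
        nlinarith
      have hln : 0 < lam * n / 2 := by positivity
      have hLlt : L < Fintype.card V := by
        have : (L:ℝ) < n := by linarith
        rw [hnd] at this; exact_mod_cast this
      have huL1 := one_le_uu (V := V) p L
      have huLp : 1 ≤ uu V p L ^ (2 * k) := one_le_pow₀ huL1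
      have hPM' : PM V p L k ((C + 1) * uu V p L ^ (2 * k)) := by
        refine ⟨by positivity, fun U U' a b d e => ((hPM L).2 U U' a b d e).trans ?_⟩
        have : 0 ≤ pw V U U' := by
          unfold pw; split_ifs <;> positivity
        gcongr; linarith
      have := step_bound h0 hp1 hB hy hLlt hPM' (one_le_mul_of_one_le_of_one_le (by linarith) huLp) hκ hP h3 hk hc t
      rw [dist_comm, dist_eq_norm]
      refine this.trans ?_
      rw [hM]
      refine mul_le_mul ?_ ?_ (by positivity) (by positivity)
      · rw [inv_le_comm₀ (by linarith) (by positivity), inv_div]; exact hge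
      · gcongr
    have hd := dist_le_Ico_sum_of_dist_le (f := f) (le_trans (min_le_left m N) (le_max_left m N)) (d := fun _ => M)
      (fun {L} a b => hstep L a b)
    rw [Finset.sum_const, Nat.card_Ico, nsmul_eq_mul] at hd
    have hdd : dist (f m) (f N) = dist (f (min m N)) (f (max m N)) := by
      rcases le_total m N with h | h
      · rw [min_eq_left h, max_eq_right h]
      · rw [min_eq_right h, max_eq_left h, dist_comm]
    have hcnt : ((max m N - min m N : ℕ) : ℝ) = |(N:ℝ) - m| := by
      rcases le_total m N with h | h
      · have : (m:ℝ) ≤ N := by exact_mod_cast h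
        rw [min_eq_left h, max_eq_right h, Nat.cast_sub h, abs_of_nonneg (by linarith)]
      · have : (N:ℝ) ≤ m := by exact_mod_cast h
        rw [min_eq_right h, max_eq_left h, Nat.cast_sub h, abs_of_nonpos (by linarith)]; ring
    rw [hcnt, ← hdd] at hd
    rw [← dist_eq_norm]
    refine hd.trans ?_
    have hM0 : 0 ≤ M := by positivity
    calc |(N:ℝ) - m| * M ≤ (R * u) * M := by gcongr; exact hDl.trans hsvu
      _ = (2 / lam * (C6 * (C + 1))) * τ * u ^ (2 * k + 1) / R := by
          rw [hM, ← hRn]; field_simp; ring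
      _ ≤ _ := by
          have : 0 ≤ 2 * (κ * B ^ k * K) * (2 / lam) ^ 3 := by positivity
          gcongr
          linarith
  · have hRu : R ≤ 2 / lam * u := by
      have h1 : lam * n / 2 ≤ R * u := by linarith
      have h2 : R * (lam * R / 2) ≤ R * u := by
        calc _ = lam * n / 2 := by rw [← hRn]; ring
          _ ≤ _ := h1
      have h3 := le_of_mul_le_mul_left h2 (by linarith)
      rw [div_mul_eq_mul_div, le_div_iff₀ hl]; linarith
    have hw := poly_le hn hB hy hκ hP h3 hk hc
    rw [← hnd] at hw
    have hfin : ∀ x : V → Bool, ‖ce t (poly T c p x) - 1‖ ≤ |t| * (κ * B ^ k * K * n) := fun x =>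
      (ce_sub_one _ _).trans (mul_le_mul_of_nonneg_left (hw x) (abs_nonneg _))
    have hone : ∀ L, L ≤ Fintype.card V → PL L (fun x : V → Bool => (1:ℂ)) = 1 := by
      intro L hL
      obtain ⟨A, _, hA⟩ := Finset.exists_subset_card_eq (s := (Finset.univ : Finset V)) (n := L) (by rwa [Finset.card_univ])
      have hmem : (fun i => decide (i ∈ A)) ∈ sl V L := by
        rw [mem_sl, tcount]; simp [hA]
      have : ((sl V L).card : ℝ) ≠ 0 := by
        exact_mod_cast (Finset.card_pos.2 ⟨_, hmem⟩).ne'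
      simp only [PL, Finset.sum_const, ← Nat.cast_smul_eq_nsmul ℝ, smul_smul]
      rw [inv_mul_cancel₀ this, one_smul]
    have hmn : m ≤ Fintype.card V := by
      have : (m:ℝ) ≤ n := by rw [← hp]; nlinarith
      rw [hnd] at this; exact_mod_cast this
    have e : ∀ L, L ≤ Fintype.card V → ‖PL L (fun x => ce t (poly T c p x)) - 1‖ ≤ |t| * (κ * B ^ k * K * n) := by
      intro L hL
      rw [← hone L hL, ← PL_sub]
      exact norm_PL_le' L (by positivity) hfin
    have hsplit : PL m (fun x => ce t (poly T c p x)) - PL N (fun x => ce t (poly T c p x)) =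
      (PL m (fun x => ce t (poly T c p x)) - 1) - (PL N (fun x => ce t (poly T c p x)) - 1) := by ring
    rw [hsplit]
    refine (norm_sub_le _ _).trans ((add_le_add (e m hmn) (e N hN)).trans ?_)
    have htτ : |t| ≤ τ := by rw [hτ]; have := sq_nonneg t; linarith
    calc _ = 2 * (κ * B ^ k * K) * |t| * (R ^ 3) / R := by rw [← hRn]; field_simp; ring
      _ ≤ 2 * (κ * B ^ k * K) * τ * ((2 / lam * u) ^ 3) / R := by gcongr
      _ = 2 * (κ * B ^ k * K) * (2 / lam) ^ 3 * τ * u ^ 3 / R := by ring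
      _ ≤ (2 / lam * (C6 * (C + 1)) + 2 * (κ * B ^ k * K) * (2 / lam) ^ 3) * τ * u ^ (2 * k + 1) / R := by
          have : 0 ≤ 2 / lam * (C6 * (C + 1)) := by positivity
          gcongr
          · linarith
          · omega

end Transfer

open MeasureTheory ProbabilityTheory
open scoped ENNReal NNReal

noncomputable section Slices
variable {V ι : Type} [Fintype V] [DecidableEq V] [Fintype ι]

lemma tcount_le (x : V → Bool) : tcount x ≤ Fintype.card V := Finset.card_le_univ _

lemma wt_tcount (p : ℝ) (x : V → Bool) :
    ∏ i, wtb p (x i) = p ^ tcount x * (1 - p) ^ (Fintype.card V - tcount x) := by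
  unfold wtb tcount
  rw [Finset.prod_ite]
  simp only [Finset.prod_const]
  congr 2
  have := Finset.card_filter_add_card_filter_not (s := (Finset.univ : Finset V)) (fun i => x i = true)
  rw [Finset.card_univ] at this
  omega

lemma Ex_fiber {E : Type} [AddCommGroup E] [Module ℝ E] (p : ℝ) (f : (V → Bool) → E) :
    Ex p f = Ex p (fun x : V → Bool => PL (tcount x) f) := by
  symm
  simp only [Ex, PL, Finset.smul_sum, sl, Finset.sum_filter]
  rw [Finset.sum_comm]
  refine Finset.sum_congr rfl fun y _ => ?_
  have hy : (sl V (tcount y)).card ≠ 0 := by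
    rw [← Nat.pos_iff_ne_zero, Finset.card_pos]; exact ⟨y, by simp [mem_sl]⟩
  have hy' : ((sl V (tcount y)).card : ℝ) ≠ 0 := by exact_mod_cast hy
  have : ∀ x : V → Bool, (∏ i, wtb p (x i)) • ((sl V (tcount x)).card : ℝ)⁻¹ • (if tcount y = tcount x then f y else 0)
      = if tcount x = tcount y then ((∏ i, wtb p (y i)) • ((sl V (tcount y)).card : ℝ)⁻¹ • f y) else 0 := by
    intro x
    by_cases h : tcount x = tcount y
    · rw [if_pos h.symm, if_pos h, wt_tcount, wt_tcount, h]
    · rw [if_neg (Ne.symm h), if_neg h]; simp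
  refine (Finset.sum_congr rfl fun x _ => this x).trans ?_
  rw [← Finset.sum_filter, Finset.sum_const]
  change (sl V (tcount y)).card • _ = _
  rw [← Nat.cast_smul_eq_nsmul ℝ, smul_smul, smul_smul]
  congr 1
  field_simp

lemma exp_moment {p B : ℝ} (h0 : 0 < p) (h1 : p < 1) (hB : 1 ≤ B) (hy : ∀ b, |yv p b| ≤ B)
    (hn : 0 < Fintype.card V) {θ : ℝ} (hθ : |θ| = 1 / (B * Real.sqrt (Fintype.card V))) :
    Ex p (fun x : V → Bool => Real.exp (θ * ∑ i, yv p (x i))) ≤ Real.exp 1 := by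
  have hn1 : (1:ℝ) ≤ Fintype.card V := by exact_mod_cast hn
  have hR : 1 ≤ Real.sqrt (Fintype.card V) := by rw [Real.one_le_sqrt]; exact hn1
  have hRR : Real.sqrt (Fintype.card V) ^ 2 = Fintype.card V := Real.sq_sqrt (by positivity)
  have e : (fun x : V → Bool => Real.exp (θ * ∑ i, yv p (x i))) = fun x => ∏ i, (fun b => Real.exp (θ * yv p b)) (x i) := by
    funext x; rw [Finset.mul_sum, Real.exp_sum]
  rw [e, Ex_prod p (fun _ b => Real.exp (θ * yv p b))]
  have hθy : ∀ b, |θ * yv p b| ≤ 1 := by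
    intro b
    rw [abs_mul, hθ]
    calc _ ≤ 1 / (B * Real.sqrt (Fintype.card V)) * B := by gcongr; exact hy b
      _ = 1 / Real.sqrt (Fintype.card V) := by field_simp
      _ ≤ 1 := by rw [div_le_one (by linarith)]; exact hR
  have hb : ∀ b, Real.exp (θ * yv p b) ≤ 1 + θ * yv p b + (θ * yv p b) ^ 2 := by
    intro b
    have := (abs_le.1 (Real.abs_exp_sub_one_sub_id_le (hθy b))).2
    linarith
  have hf : p * Real.exp (θ * yv p true) + (1 - p) * Real.exp (θ * yv p false) ≤ Real.exp (θ ^ 2) := by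
    have m := yv_mean (p := p)
    have s := yv_sq h0 h1
    have := Real.add_one_le_exp (θ ^ 2)
    have a := mul_le_mul_of_nonneg_left (hb true) h0.le
    have b := mul_le_mul_of_nonneg_left (hb false) (sub_nonneg.2 h1.le)
    have : p * (1 + θ * yv p true + (θ * yv p true) ^ 2) + (1 - p) * (1 + θ * yv p false + (θ * yv p false) ^ 2) = 1 + θ ^ 2 := by
      linear_combination θ * m + θ ^ 2 * s
    linarith
  calc _ ≤ ∏ i : V, Real.exp (θ ^ 2) := Finset.prod_le_prod (fun i _ => by
          have := sub_pos.2 h1; positivity) (fun i _ => hf)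
    _ = Real.exp (Fintype.card V * θ ^ 2) := by rw [← Real.exp_sum]; simp
    _ ≤ Real.exp 1 := by
      apply Real.exp_le_exp.2
      rw [← sq_abs, hθ, div_pow, mul_pow, hRR]
      have : (1:ℝ) ≤ B ^ 2 := one_le_pow₀ hB
      rw [one_pow, mul_one_div, div_le_one (by positivity)]
      nlinarith

lemma uu_moment {p B : ℝ} (h0 : 0 < p) (h1 : p < 1) (hB : 1 ≤ B) (hy : ∀ b, |yv p b| ≤ B)
    (hn : 0 < Fintype.card V) (q : ℕ) :
    Ex p (fun x : V → Bool => uu V p (tcount x) ^ q) ≤ 2 * Real.exp 1 ^ 2 * B ^ q * q.factorial := by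
  have hn1 : (1:ℝ) ≤ Fintype.card V := by exact_mod_cast hn
  have hR : 1 ≤ Real.sqrt (Fintype.card V) := by rw [Real.one_le_sqrt]; exact hn1
  set R := Real.sqrt (Fintype.card V) with hRd
  have key : ∀ x : V → Bool, uu V p (tcount x) ^ q ≤ (B ^ q * q.factorial * Real.exp 1) *
      (Real.exp (1 / (B * R) * ∑ i, yv p (x i)) + Real.exp (-(1 / (B * R)) * ∑ i, yv p (x i))) := by
    intro x
    rw [sum_yv]
    set S := sv V p (tcount x)
    have hu : uu V p (tcount x) = 1 + |S| / R := rfl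
    have hu1 := one_le_uu (V := V) p (tcount x)
    have a := Real.pow_div_factorial_le_exp (uu V p (tcount x) / B) (by positivity) q
    have b : Real.exp (uu V p (tcount x) / B) ≤ Real.exp 1 * Real.exp |1 / (B * R) * S| := by
      rw [← Real.exp_add]
      apply Real.exp_le_exp.2
      rw [hu, abs_mul, abs_of_pos (by positivity : 0 < 1 / (B * R)), add_div]
      have : 1 / B ≤ 1 := by rw [div_le_one (by linarith)]; exact hB
      have : |S| / R / B = 1 / (B * R) * |S| := by field_simp
      linarith
    have c : Real.exp |1 / (B * R) * S| ≤ Real.exp (1 / (B * R) * S) + Real.exp (-(1 / (B * R)) * S) := by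
      rcases abs_cases (1 / (B * R) * S) with h | h
      · rw [h.1]; have := Real.exp_pos (-(1 / (B * R)) * S); linarith
      · rw [h.1, ← neg_mul]; have := Real.exp_pos ((1 / (B * R)) * S); linarith
    have hf : (0:ℝ) < q.factorial := by exact_mod_cast q.factorial_pos
    rw [div_pow, div_div, div_le_iff₀ (by positivity)] at a
    calc _ ≤ _ := a
      _ ≤ (Real.exp 1 * (Real.exp (1 / (B * R) * S) + Real.exp (-(1 / (B * R)) * S))) * (B ^ q * q.factorial) := by
        gcongr; exact b.trans (by gcongr)
      _ = _ := by ring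
  refine (Ex_mono h0.le h1.le key).trans ?_
  rw [Ex_mul, Ex_add]
  have p1 : (0:ℝ) < 1 / (B * R) := by positivity
  have A := exp_moment (V := V) h0 h1 hB hy hn (θ := 1 / (B * R)) (abs_of_pos p1)
  have A' := exp_moment (V := V) h0 h1 hB hy hn (θ := -(1 / (B * R))) (by rw [abs_neg, abs_of_pos p1])
  calc _ ≤ (B ^ q * q.factorial * Real.exp 1) * (Real.exp 1 + Real.exp 1) := by gcongr
    _ = _ := by ring

/-- abstract theorem -/
theorem abstract_main (k K : ℕ) (lam κ B : ℝ) (hk1 : 1 ≤ k) (hl : 0 < lam) (hκ : 0 ≤ κ) (hB : 1 ≤ B) :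
    ∃ C : ℝ, 0 ≤ C ∧ ∀ (V ι : Type) [Fintype V] [DecidableEq V] [Fintype ι] (p : ℝ) (m : ℕ) (T : ι → Finset V)
      (c : ι → ℝ), 0 < p → p < 1 - lam → 0 < Fintype.card V → p * Fintype.card V = m →
      (∀ b, |yv p b| ≤ B) → P2 T K → (∀ α, 3 ≤ (T α).card) → (∀ α, (T α).card ≤ k) →
      (∀ α, |c α| ≤ κ / Fintype.card V) → Ex p (fun x => poly T c p x ^ 2) = 1 → ∀ t : ℝ,
      ‖PL m (fun x => ce t (poly T c p x)) - ((Real.exp (-(t^2)/2) : ℝ) : ℂ)‖ ≤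
        C * (|t| + |t| ^ 3) / Real.sqrt (Fintype.card V) := by
  obtain ⟨C, hC, hpm⟩ := pair_moment hB k
  have hE0 : 0 ≤ EE κ k K := by unfold EE; positivity
  set D1 : ℝ := (2 / lam * ((8 * B ^ 2 + 2 * B + 1) * (1 + EE κ k K) * (C + 1)) + 2 * (κ * B ^ k * K) * (2 / lam) ^ 3) with hD1
  set D2 : ℝ := 2 * Real.exp 1 ^ 2 * B ^ (2 * k + 1) * (2 * k + 1).factorial with hD2
  set D3 : ℝ := (κ*B^k)^4*(72*k^7*K^4)+1 with hD3
  set D4 : ℝ := 3*B^3*(1+2*((κ*B^k)^4*(27*k^4*K^4))) with hD4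
  have q1 : 0 ≤ D1 := by positivity
  have q2 : 0 ≤ D2 := by positivity
  have q3 : 0 ≤ D3 := by positivity
  have q4 : 0 ≤ D4 := by positivity
  refine ⟨2 * D1 * D2 + D3 + D4, by positivity, ?_⟩
  intro V ι _ _ _ p m T c h0 h1 hn hp hy hP h3 hk hc hv t
  have hp1 : p < 1 := by linarith
  have : Nonempty V := Fintype.card_pos_iff.1 hn
  have hn1 : (1:ℝ) ≤ Fintype.card V := by exact_mod_cast hn
  have hR : 1 ≤ Real.sqrt (Fintype.card V) := by rw [Real.one_le_sqrt]; exact hn1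
  set f : (V → Bool) → ℂ := fun x => ce t (poly T c p x) with hf
  have A := iid_clt h0 hp1 hB hy hκ hP h3 hk hc hv t
  rw [← hD3, ← hD4] at A
  have Bd : ‖PL m f - Ex p f‖ ≤ D1 * (|t| + t ^ 2) / Real.sqrt (Fintype.card V) * D2 := by
    have e1 : PL m f - Ex p f = Ex p (fun x : V → Bool => PL m f - PL (tcount x) f) := by
      rw [Ex_sub, ← Ex_fiber]
      congr 1
      have := Ex_cmul (V := V) p (PL m f) (fun _ => 1)
      have h2 : Ex p (fun _ : V → Bool => (1:ℂ)) = 1 := by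
        have h3 := Ex_const (V := V) p 1
        simp only [Ex, smul_eq_mul, mul_one] at h3
        simp only [Ex, ← Finset.sum_smul]
        rw [h3, one_smul]
      simp only [mul_one, h2] at this
      exact this.symm
    rw [e1]
    refine (norm_Ex_le h0.le hp1.le _).trans ?_
    refine (Ex_mono h0.le hp1.le (g := fun x => (D1 * (|t| + t ^ 2) / Real.sqrt (Fintype.card V)) * uu V p (tcount x) ^ (2 * k + 1)) ?_).trans ?_
    · intro x
      have := chain_bound (m := m) hl h0 h1 hB hk1 hn hp hy hC (fun L => ⟨by
        have := one_le_uu (V := V) p L; positivity, fun U U' a b c d => hpm V p hn hy L U U' a b c d⟩) hκ hP h3 hk hc t (tcount_le x)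
      refine this.trans (le_of_eq ?_)
      rw [← hD1]; ring
    · rw [Ex_mul]
      gcongr
      exact uu_moment h0 hp1 hB hy hn _
  have ht2 : t ^ 2 ≤ |t| + |t| ^ 3 := by
    rw [← sq_abs]
    nlinarith [mul_nonneg (abs_nonneg t) (sq_nonneg (|t| - 1)), abs_nonneg t, pow_nonneg (abs_nonneg t) 3]
  have a0 := abs_nonneg t
  have a3 := pow_nonneg a0 3
  calc _ ≤ ‖PL m f - Ex p f‖ + ‖Ex p f - ((Real.exp (-(t^2)/2) : ℝ) : ℂ)‖ := norm_sub_le_norm_sub_add_norm_sub _ _ _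
    _ ≤ D1 * (|t| + t ^ 2) / Real.sqrt (Fintype.card V) * D2 + (D3 * t ^ 2 + D4 * |t| ^ 3) / Real.sqrt (Fintype.card V) := add_le_add Bd A
    _ = (D1 * D2 * (|t| + t ^ 2) + D3 * t ^ 2 + D4 * |t| ^ 3) / Real.sqrt (Fintype.card V) := by ring
    _ ≤ _ := by
      apply div_le_div_of_nonneg_right _ (by positivity)
      have z1 : D1 * D2 * (|t| + t ^ 2) ≤ D1 * D2 * (2 * (|t| + |t| ^ 3)) := by gcongr; linarith
      have z2 : D3 * t ^ 2 ≤ D3 * (|t| + |t| ^ 3) := by gcongr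
      have z3 : D4 * |t| ^ 3 ≤ D4 * (|t| + |t| ^ 3) := by gcongr; linarith
      linarith

end Slices

open MeasureTheory ProbabilityTheory
open scoped ENNReal NNReal

noncomputable section Concrete

lemma integral_bern {V : Type} [Fintype V] [DecidableEq V] {p : ℝ} (h0 : 0 ≤ p) (h1 : p ≤ 1)
    {E : Type} [NormedAddCommGroup E] [NormedSpace ℝ E] [CompleteSpace E] (f : (V → Bool) → E) :
    ∫ x, f x ∂(bernoulliPi V p) = Ex p f := by
  unfold bernoulliPi Ex
  rw [integral_finsetSum_measure]
  · refine Finset.sum_congr rfl fun x _ => ?_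
    rw [integral_smul_measure, integral_dirac, ENNReal.toReal_prod]
    congr 1
    refine Finset.prod_congr rfl fun i _ => ?_
    unfold wtb
    rw [ENNReal.toReal_ofReal]
    split_ifs <;> linarith
  · intro x _
    refine Integrable.smul_measure ?_ ?_
    · exact Integrable.of_finite
    · exact ENNReal.prod_ne_top fun i _ => ENNReal.ofReal_ne_top

lemma integral_unif {n : ℕ} [NeZero n] (m : ℕ)
    {E : Type} [NormedAddCommGroup E] [NormedSpace ℝ E] [CompleteSpace E] (f : (ZMod n → Bool) → E) :
    ∫ x, f x ∂(uniformSubset n m) = PL m f := by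
  unfold uniformSubset finUniform PL
  rw [integral_smul_measure, integral_finsetSum_measure]
  · congr 1
    · rw [ENNReal.toReal_inv, ENNReal.toReal_natCast, Nat.card_eq_fintype_card, Fintype.card_subtype]
      rfl
    · rw [sl, Finset.sum_filter]
      refine Finset.sum_congr rfl fun x _ => ?_
      rw [integral_smul_measure, integral_dirac]
      by_cases h : tcount x = m
      · rw [if_pos h, Set.indicator_of_mem (by exact h)]; simp
      · rw [if_neg h, Set.indicator_of_notMem (by exact h)]; simp
  · intro x _
    refine Integrable.smul_measure ?_ ?_
    · exact Integrable.of_finite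
    · by_cases h : tcount x = m
      · rw [Set.indicator_of_mem (by exact h)]; simp
      · rw [Set.indicator_of_notMem (by exact h)]; simp

lemma unit_sub {n k : ℕ} (hg : Nat.gcd n (Nat.factorial (k - 1)) = 1) {i j : ℕ} (hi : i < k) (hj : j < k)
    (hij : i ≠ j) : IsUnit ((j : ZMod n) - i) := by
  wlog h : i < j generalizing i j
  · have := this hj hi hij.symm (by omega)
    rw [← neg_sub]; exact this.neg
  rw [← Nat.cast_sub h.le, ZMod.isUnit_iff_coprime]
  have h2 : (j - i) ∣ Nat.factorial (k - 1) := Nat.dvd_factorial (by omega) (by omega)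
  exact (Nat.Coprime.coprime_dvd_right h2 hg).symm

/-- index set -/
def JJ (n k : ℕ) [NeZero n] : Finset (ZMod n × ℕ × Finset ℕ) :=
  Finset.univ ×ˢ (Finset.Icc 1 (n / 2) ×ˢ ((Finset.range k).powerset.filter fun S => 3 ≤ S.card))

def TT (n k : ℕ) [NeZero n] (α : JJ n k) : Finset (ZMod n) :=
  α.1.2.2.image fun i => α.1.1 + ((i * α.1.2.1 : ℕ) : ZMod n)

def cf (n k : ℕ) [NeZero n] (p : ℝ) (α : JJ n k) : ℝ :=
  p ^ (k - α.1.2.2.card) * Real.sqrt (p * (1 - p)) ^ α.1.2.2.card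

variable {n k : ℕ} [NeZero n]

lemma JJ_mem (α : JJ n k) : 1 ≤ α.1.2.1 ∧ α.1.2.1 ≤ n / 2 ∧ α.1.2.2 ⊆ Finset.range k ∧ 3 ≤ α.1.2.2.card := by
  have := α.2
  simp [JJ] at this
  exact ⟨this.1.1, this.1.2, this.2.1, this.2.2⟩

lemma d_inj {d d' : ℕ} (h : d ≤ n / 2) (h' : d' ≤ n / 2) (hd : (d : ZMod n) = d') : d = d' := by
  have hn : 0 < n := Nat.pos_of_ne_zero (NeZero.ne n)
  rw [ZMod.natCast_eq_natCast_iff] at hd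
  exact Nat.ModEq.eq_of_lt_of_lt hd (by omega) (by omega)

lemma TT_inj (hg : Nat.gcd n (Nat.factorial (k - 1)) = 1) (α : JJ n k) :
    Set.InjOn (fun i : ℕ => α.1.1 + ((i * α.1.2.1 : ℕ) : ZMod n)) α.1.2.2 := by
  obtain ⟨h1, h2, h3, _⟩ := JJ_mem α
  intro i hi j hj hij
  by_contra hne
  have hi' := Finset.mem_range.1 (h3 hi)
  have hj' := Finset.mem_range.1 (h3 hj)
  have u := unit_sub hg hi' hj' hne
  simp only [Nat.cast_mul, add_right_inj] at hij
  have : ((j : ZMod n) - i) * (α.1.2.1 : ZMod n) = 0 := by linear_combination -hij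
  rw [u.mul_right_eq_zero] at this
  have := d_inj (n := n) (d' := 0) h2 (by omega) (by simpa using this)
  omega

lemma TT_card (hg : Nat.gcd n (Nat.factorial (k - 1)) = 1) (α : JJ n k) :
    (TT n k α).card = α.1.2.2.card := Finset.card_image_of_injOn (TT_inj hg α)

lemma TT_le (hg : Nat.gcd n (Nat.factorial (k - 1)) = 1) (α : JJ n k) : (TT n k α).card ≤ k := by
  rw [TT_card hg]
  simpa using Finset.card_le_card (JJ_mem α).2.2.1

lemma kAP_poly (hg : Nat.gcd n (Nat.factorial (k - 1)) = 1) (p : ℝ) (x : ZMod n → Bool) :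
    kAPprime k p x = poly (TT n k) (cf n k p) p x := by
  unfold poly
  have e : ∀ α : JJ n k, cf n k p α * mon p (TT n k α) x =
      (fun z : ZMod n × ℕ × Finset ℕ => p ^ (k - z.2.2.card) * Real.sqrt (p * (1 - p)) ^ z.2.2.card *
        ∏ i ∈ z.2.2, yv p (x (z.1 + ((i * z.2.1 : ℕ) : ZMod n)))) α.1 := by
    intro α
    simp only [cf, mon, TT]
    rw [Finset.prod_image (TT_inj hg α)]
  rw [Finset.sum_congr rfl fun α _ => e α, Finset.sum_coe_sort (JJ n k) (fun z : ZMod n × ℕ × Finset ℕ => p ^ (k - z.2.2.card) * Real.sqrt (p * (1 - p)) ^ z.2.2.card *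
        ∏ i ∈ z.2.2, yv p (x (z.1 + ((i * z.2.1 : ℕ) : ZMod n)))), JJ, Finset.sum_product]
  unfold kAPprime
  refine Finset.sum_congr rfl fun a _ => ?_
  rw [Finset.sum_product]
  refine Finset.sum_congr rfl fun d _ => ?_
  rw [Finset.sum_filter]
  rfl

lemma TT_P2 (hg : Nat.gcd n (Nat.factorial (k - 1)) = 1) : P2 (TT n k) (k * (k * 2 ^ k)) := by
  classical
  intro u v huv
  have h := cnt_exists (α := JJ n k) (Finset.range k ×ˢ (Finset.range k ×ˢ (Finset.range k).powerset))
    (fun b α => α.1.1 + ((b.1 * α.1.2.1 : ℕ) : ZMod n) = u ∧ α.1.1 + ((b.2.1 * α.1.2.1 : ℕ) : ZMod n) = v ∧ α.1.2.2 = b.2.2) 1 ?_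
  · simp only [Finset.card_product, Finset.card_range, Finset.card_powerset, mul_one] at h
    refine le_trans (cnt_mono ?_) h
    rintro α ⟨hu, hv⟩
    simp only [TT, Finset.mem_image] at hu hv
    obtain ⟨i, hi, hu⟩ := hu
    obtain ⟨j, hj, hv⟩ := hv
    have h3 := (JJ_mem α).2.2.1
    exact ⟨(i, j, α.1.2.2), by simp [Finset.mem_range.1 (h3 hi), Finset.mem_range.1 (h3 hj)]; simpa using h3, hu, hv, rfl⟩
  · rintro ⟨i, j, S⟩ hb
    simp only [Finset.mem_product, Finset.mem_range] at hb
    rw [cnt_eq, Finset.card_le_one]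
    rintro α ha β hb'
    simp only [Finset.mem_filter, Finset.mem_univ, true_and, Nat.cast_mul] at ha hb'
    obtain ⟨a1, a2, a3⟩ := ha
    obtain ⟨b1, b2, b3⟩ := hb'
    have hij : i ≠ j := by
      rintro rfl; exact huv (a1.symm.trans a2)
    have U := unit_sub hg hb.1 hb.2.1 hij
    have hd : (α.1.2.1 : ZMod n) = β.1.2.1 := by
      apply U.mul_left_cancel
      linear_combination a2 - a1 - b2 + b1
    have hd' := d_inj (JJ_mem α).2.1 (JJ_mem β).2.1 hd
    have ha' : α.1.1 = β.1.1 := by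
      rw [hd] at a1
      linear_combination a1 - b1
    apply Subtype.ext
    exact Prod.ext ha' (Prod.ext hd' (a3.trans b3.symm))

lemma JJ_card (hk : 3 ≤ k) (hn : 2 ≤ n) : (n:ℝ) ^ 2 / 4 ≤ Fintype.card (JJ n k) := by
  rw [Fintype.card_coe, JJ, Finset.card_product, Finset.card_product, Finset.card_univ, ZMod.card, Nat.card_Icc]
  have h1 : 1 ≤ ((Finset.range k).powerset.filter fun S => 3 ≤ S.card).card := by
    rw [Nat.one_le_iff_ne_zero, ← Nat.pos_iff_ne_zero, Finset.card_pos]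
    exact ⟨Finset.range k, by simp [hk]⟩
  have h2 : n ≤ 4 * (n / 2) := by omega
  have h3 : n * n ≤ 4 * (n * ((n / 2 + 1 - 1) * ((Finset.range k).powerset.filter fun S => 3 ≤ S.card).card)) := by
    rw [Nat.add_sub_cancel]
    calc n * n ≤ n * (4 * (n / 2) * 1) := by rw [mul_one]; exact Nat.mul_le_mul_left _ h2
      _ ≤ n * (4 * (n / 2) * ((Finset.range k).powerset.filter fun S => 3 ≤ S.card).card) := by gcongr
      _ = _ := by ring
  have h4 : (n:ℝ) * n ≤ 4 * ((n * ((n / 2 + 1 - 1) * ((Finset.range k).powerset.filter fun S => 3 ≤ S.card).card) : ℕ) : ℝ) := by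
    exact_mod_cast h3
  rw [pow_two]; linarith

lemma Ex_mon_zero {V : Type} [Fintype V] [DecidableEq V] (p : ℝ) {A : Finset V} (hA : A.Nonempty) :
    Ex p (mon p A) = 0 := by
  obtain ⟨j, hj⟩ := hA
  have := Ex_y_indep (p := p) (mon_indep p (A.erase j) j (by simp))
  rw [← this]
  congr 1
  funext x
  exact (mon_erase hj x).symm

lemma var_lower {V ι : Type} [Fintype V] [DecidableEq V] [Fintype ι] {p : ℝ} (h0 : 0 < p) (h1 : p < 1)
    (T : ι → Finset V) (c : ι → ℝ) {l : ℝ} (hl : 0 ≤ l) (hc : ∀ α, l ≤ c α) :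
    l ^ 2 * Fintype.card ι ≤ Ex p (fun x => poly T c p x ^ 2) := by
  classical
  have e : (fun x => poly T c p x ^ 2) = fun x => ∑ α, ∑ β, (c α * c β) * (mon p (T α) x * mon p (T β) x) := by
    funext x
    rw [poly, pow_two, Finset.sum_mul_sum]
    exact Finset.sum_congr rfl fun α _ => Finset.sum_congr rfl fun β _ => by ring
  rw [e, Ex_sum]
  have : ∀ α, l ^ 2 ≤ Ex p (fun x => ∑ β, (c α * c β) * (mon p (T α) x * mon p (T β) x)) := by
    intro α
    rw [Ex_sum]
    refine le_trans ?_ (Finset.single_le_sum (f := fun β => Ex p (fun x => (c α * c β) * (mon p (T α) x * mon p (T β) x))) ?_ (Finset.mem_univ α))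
    · simp only [Ex_mul]
      rw [mon_sq h0 h1, mul_one, ← pow_two]
      exact pow_le_pow_left₀ hl (hc α) 2
    · intro β _
      simp only [Ex_mul]
      exact mul_nonneg (mul_nonneg (hl.trans (hc _)) (hl.trans (hc _))) (mon_mul_mon_nonneg h0 h1 _ _)
  calc l ^ 2 * Fintype.card ι = ∑ α : ι, l ^ 2 := by simp [mul_comm]
    _ ≤ _ := Finset.sum_le_sum fun α _ => this α

end Concrete

theorem kAP_prime_char_fun_low_range
    (k : ℕ) (hk : 3 ≤ k) (lam ε : ℝ)
    (hlam : lam ∈ Set.Ioo (0 : ℝ) (1 / 2)) (hε : 0 < ε) :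
    ∃ C : ℝ, 0 < C ∧ ∀ (n : ℕ) [NeZero n], Nat.gcd n (Nat.factorial (k - 1)) = 1 →
      ∀ m : ℕ, (m : ℝ) / n ∈ Set.Ioo lam (1 - lam) →
      let p : ℝ := (m : ℝ) / n
      let μ := uniformSubset n m
      let σ := Real.sqrt (∫ x, (kAPprime k p x -
        ∫ y, kAPprime k p y ∂(bernoulliPi (ZMod n) p)) ^ 2 ∂(bernoulliPi (ZMod n) p))
      ∀ t : ℝ,
        ‖(∫ x, Complex.exp (Complex.I * Complex.ofReal (t * (kAPprime k p x / σ))) ∂μ) -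
            Complex.ofReal (Real.exp (-(t ^ 2) / 2))‖
          ≤ C * (|t| * (n : ℝ) ^ (ε - 1 / 4) + |t| ^ 3 * (n : ℝ) ^ (-(1 : ℝ) / 2)) := by
  obtain ⟨hl0, hl1⟩ := hlam
  have hB : 1 ≤ 1 / lam := by rw [le_div_iff₀ hl0]; linarith
  obtain ⟨C, hC, hmain⟩ := abstract_main k (k * (k * 2 ^ k)) lam (2 / lam ^ k) (1 / lam) (by omega) hl0
    (by positivity) hB
  refine ⟨C + 1, by linarith, ?_⟩
  intro n _ hg m hm p μ σ t
  have hp0 : lam < p := hm.1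
  have hp1 : p < 1 - lam := hm.2
  have h0 : 0 < p := by linarith
  have h1 : p < 1 := by linarith
  have hn0 : 0 < n := Nat.pos_of_ne_zero (NeZero.ne n)
  have hnR : (0:ℝ) < n := by exact_mod_cast hn0
  have hpm : p * n = m := by simp only [p]; field_simp
  have hn2 : 2 ≤ n := by
    by_contra h
    have : n = 1 := by omega
    have hnn : (n:ℝ) = 1 := by exact_mod_cast this
    rw [hnn, mul_one] at hpm
    rw [hpm] at h0 h1
    have a : 0 < m := by exact_mod_cast h0
    have b : m < 1 := by exact_mod_cast h1
    omega
  have hs : lam ≤ Real.sqrt (p * (1 - p)) := by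
    apply Real.le_sqrt_of_sq_le
    nlinarith
  have hs1 := s_le_one (p := p)
  have hy : ∀ b, |yv p b| ≤ 1 / lam := by
    intro b
    rw [yv, abs_div, abs_of_pos (s_pos h0 h1)]
    apply div_le_div₀ (by norm_num) _ hl0 hs
    rw [abs_le]
    split_ifs <;> constructor <;> linarith
  have hcard : ∀ α : JJ n k, α.1.2.2.card ≤ k := fun α => by rw [← TT_card hg]; exact TT_le hg α
  have hc1 : ∀ α, lam ^ k ≤ cf n k p α := by
    intro α
    calc lam ^ k = lam ^ (k - α.1.2.2.card) * lam ^ α.1.2.2.card := by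
          rw [← pow_add, Nat.sub_add_cancel (hcard α)]
      _ ≤ _ := by unfold cf; gcongr
  have hc2 : ∀ α, cf n k p α ≤ 1 := by
    intro α
    unfold cf
    exact mul_le_one₀ (pow_le_one₀ h0.le h1.le) (by positivity) (pow_le_one₀ (by positivity) hs1)
  set Y : (ZMod n → Bool) → ℝ := poly (TT n k) (cf n k p) p with hY
  have hkY : ∀ x : ZMod n → Bool, kAPprime k p x = Y x := fun x => kAP_poly hg p x
  have hmean : Ex p Y = 0 := by
    have : Y = fun x => ∑ α, cf n k p α * mon p (TT n k α) x := rfl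
    rw [this, Ex_sum]
    refine Finset.sum_eq_zero fun α _ => ?_
    rw [Ex_mul]
    have := Ex_mon_zero p (A := TT n k α) (by
      rw [← Finset.card_pos, TT_card hg]; have := (JJ_mem α).2.2.2; omega)
    rw [show Ex p (fun x => mon p (TT n k α) x) = 0 from this, mul_zero]
  have hσ : σ = Real.sqrt (Ex p (fun x => Y x ^ 2)) := by
    simp only [σ, integral_bern h0.le h1.le, hkY]
    rw [show Ex p (fun y => Y y) = 0 from hmean]
    simp only [sub_zero]
  have hlow := var_lower h0 h1 (TT n k) (cf n k p) (l := lam ^ k) (by positivity) hc1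
  have hJ := JJ_card (n := n) hk hn2
  have hσl : lam ^ k * n / 2 ≤ σ := by
    rw [hσ]
    apply Real.le_sqrt_of_sq_le
    refine le_trans ?_ hlow
    calc (lam ^ k * n / 2) ^ 2 = (lam ^ k) ^ 2 * ((n:ℝ) ^ 2 / 4) := by ring
      _ ≤ _ := by gcongr
  have hσ0 : 0 < σ := lt_of_lt_of_le (by positivity) hσl
  have hσ2 : σ ^ 2 = Ex p (fun x => Y x ^ 2) := by
    rw [hσ, Real.sq_sqrt]
    exact le_trans (by positivity) hlow
  have hpoly : ∀ x, poly (TT n k) (fun α => cf n k p α / σ) p x = Y x / σ := by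
    intro x
    rw [hY, poly, poly, Finset.sum_div]
    exact Finset.sum_congr rfl fun α _ => by ring
  have hcardn : Fintype.card (ZMod n) = n := ZMod.card n
  have M := hmain (ZMod n) (JJ n k) p m (TT n k) (fun α => cf n k p α / σ) h0 hp1 (by rw [hcardn]; exact hn0)
    (by rw [hcardn]; exact hpm) hy (TT_P2 hg) (fun α => by rw [TT_card hg]; exact (JJ_mem α).2.2.2) (TT_le hg)
    (fun α => by
      rw [hcardn, abs_div, abs_of_pos hσ0, abs_of_nonneg (le_trans (by positivity) (hc1 α))]
      calc cf n k p α / σ ≤ 1 / (lam ^ k * n / 2) := div_le_div₀ (by norm_num) (hc2 α) (by positivity) hσl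
        _ = _ := by field_simp)
    (by
      simp only [hpoly, div_pow]
      have : (fun x => Y x ^ 2 / σ ^ 2) = fun x => (σ ^ 2)⁻¹ * Y x ^ 2 := by funext x; ring
      rw [this, Ex_mul, ← hσ2]
      field_simp) t
  rw [hcardn] at M
  simp only [hpoly] at M
  have hI : (∫ x, Complex.exp (Complex.I * Complex.ofReal (t * (kAPprime k p x / σ))) ∂μ) =
      PL m (fun x => ce t (Y x / σ)) := by
    simp only [hkY]
    exact integral_unif m _
  rw [hI]
  refine M.trans ?_
  have hn1 : (1:ℝ) ≤ n := by exact_mod_cast hn0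
  have e1 : 1 / Real.sqrt (n:ℝ) = (n:ℝ) ^ (-(1:ℝ) / 2) := by
    rw [Real.sqrt_eq_rpow, neg_div, Real.rpow_neg hnR.le, one_div]
  have e2 : (n:ℝ) ^ (-(1:ℝ) / 2) ≤ (n:ℝ) ^ (ε - 1 / 4) :=
    Real.rpow_le_rpow_of_exponent_le hn1 (by linarith)
  have e3 : 0 < (n:ℝ) ^ (-(1:ℝ) / 2) := Real.rpow_pos_of_pos hnR _
  have e4 : 0 < (n:ℝ) ^ (ε - 1 / 4) := Real.rpow_pos_of_pos hnR _
  calc C * (|t| + |t| ^ 3) / Real.sqrt n = C * (|t| * (n:ℝ) ^ (-(1:ℝ) / 2) + |t| ^ 3 * (n:ℝ) ^ (-(1:ℝ) / 2)) := by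
        rw [← e1]; ring
    _ ≤ (C + 1) * (|t| * (n : ℝ) ^ (ε - 1 / 4) + |t| ^ 3 * (n : ℝ) ^ (-(1 : ℝ) / 2)) := by
        gcongr; linarith
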